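/- arXiv:2506.16047 — 3 statements merged into one kernel-verified Lean document; each statement's English description precedes it below -/
import Mathlib

section
/- For all p ∈ [1,∞), all λ ∈ 𝒫_p(𝒳), and all kernels P, Q ∈ 𝒬_p(𝒳,𝒴), the chain of inequalities 𝒲_p^λ(P,Q) ≥ W_p(λ ⊛ P, λ ⊛ Q) ≥ W_p(λ ∘ P, λ ∘ Q) holds, where λ ⊛ Q ∈ 𝒫_p(𝒳×𝒴) is the semidirect product measure (λ ⊛ Q)(A×B) = ∫_A Q(B|x) λ(dx) and λ ∘ Q ∈ 𝒫_p(𝒴) is the mixture (λ ∘ Q)(B) = ∫_𝒳 Q(B|x) λ(dx). -/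
open MeasureTheory Filter

/-- Optimal transport cost between `μ` and `ν` for cost function `c`:
the infimum of `∫ c` over all couplings of `μ` and `ν`. -/
noncomputable def Wcost {α β : Type*} [MeasurableSpace α] [MeasurableSpace β]
    (c : α → β → ℝ) (μ : Measure α) (ν : Measure β) : ℝ :=
  sInf {r : ℝ | ∃ π : Measure (α × β),
    π.map Prod.fst = μ ∧ π.map Prod.snd = ν ∧ r = ∫ z, c z.1 z.2 ∂π}

/-- The Wasserstein (optimal transport) distance of order `p`. -/
noncomputable def Wp {α : Type*} [MeasurableSpace α] [PseudoMetricSpace α]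
    (p : ℝ) (μ ν : Measure α) : ℝ :=
  Wcost (fun x y => dist x y ^ p) μ ν ^ (1 / p)

/-- `μ ∈ 𝒫_p(α)`: probability measure with finite `p`-th moment. -/
def MemPp {α : Type*} [MeasurableSpace α] [PseudoMetricSpace α] (p : ℝ) (μ : Measure α) : Prop :=
  IsProbabilityMeasure μ ∧ ∀ x₀ : α, Integrable (fun x => dist x₀ x ^ p) μ

/-- `Q ∈ 𝒬_p(X, Y)`: a kernel, i.e. a measurable family of probability measures in `𝒫_p(Y)`
satisfying the growth condition `∫ d(y, y₀)^p dQ(·|x) ≤ C (1 + d(x, x₀)^p)`. -/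
def MemQp {X Y : Type*} [MeasurableSpace X] [PseudoMetricSpace X]
    [MeasurableSpace Y] [PseudoMetricSpace Y] (p : ℝ) (Q : X → Measure Y) : Prop :=
  (∀ x, IsProbabilityMeasure (Q x)) ∧
  (∀ B : Set Y, MeasurableSet B → Measurable fun x => Q x B) ∧
  (∀ x, ∀ y₀ : Y, Integrable (fun y => dist y₀ y ^ p) (Q x)) ∧
  ∃ x₀ : X, ∃ y₀ : Y, ∃ C > (0 : ℝ), ∀ x,
    (∫ y, dist y y₀ ^ p ∂(Q x)) ≤ C * (1 + dist x x₀ ^ p)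

/-- The integrated transportation distance of degree `p` with marginal `lam`. -/
noncomputable def ITD {X Y : Type*} [MeasurableSpace X] [PseudoMetricSpace X]
    [MeasurableSpace Y] [PseudoMetricSpace Y]
    (p : ℝ) (lam : Measure X) (P Q : X → Measure Y) : ℝ :=
  (∫ x, Wp p (P x) (Q x) ^ p ∂lam) ^ (1 / p)

/-- The semidirect product `λ ⊛ Q ∈ 𝒫(X × Y)`, `(λ ⊛ Q)(A × B) = ∫_A Q(B|x) λ(dx)`. -/
noncomputable def semidirect {X Y : Type*} [MeasurableSpace X] [MeasurableSpace Y]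
    (lam : Measure X) (Q : X → Measure Y) : Measure (X × Y) :=
  lam.bind fun x => (Q x).map fun y => (x, y)

/-- The mixture `λ ∘ Q ∈ 𝒫(Y)`, `(λ ∘ Q)(B) = ∫_X Q(B|x) λ(dx)`. -/
noncomputable def mix {X Y : Type*} [MeasurableSpace X] [MeasurableSpace Y]
    (lam : Measure X) (Q : X → Measure Y) : Measure Y :=
  lam.bind Q

/-- Wasserstein distance of order `p` on the product space `X × Y`, for the product metric
`((d(x,x'))^p + (d(y,y'))^p)^{1/p}`. -/
noncomputable def WpProd {X Y : Type*} [MeasurableSpace X] [PseudoMetricSpace X]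
    [MeasurableSpace Y] [PseudoMetricSpace Y] (p : ℝ) (μ ν : Measure (X × Y)) : ℝ :=
  Wcost (fun z w => dist z.1 w.1 ^ p + dist z.2 w.2 ^ p) μ ν ^ (1 / p)


namespace ITDProof
open scoped ENNReal
set_option linter.unusedSectionVars false
open ProbabilityTheory Topology

/-- Scale a density down so that its marginals are at most one. -/
noncomputable def nrm {Y : Type*} [MeasurableSpace Y] (f : Y × Y → ℝ≥0∞) (μ ν : Measure Y) :
    Y × Y → ℝ≥0∞ :=
  fun w => f w / (max 1 (∫⁻ z, f (w.1, z) ∂ν) * max 1 (∫⁻ y, f (y, w.2) ∂μ))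

/-- Complete a sub-coupling density to a coupling density. -/
noncomputable def full {Y : Type*} [MeasurableSpace Y] (f : Y × Y → ℝ≥0∞) (μ ν : Measure Y) :
    Y × Y → ℝ≥0∞ :=
  fun w => f w + (1 - ∫⁻ z, f (w.1, z) ∂ν) * (1 - ∫⁻ y, f (y, w.2) ∂μ) /
    (1 - ∫⁻ y, ∫⁻ z, f (y, z) ∂ν ∂μ)

/-- The coupling associated with a density. -/
noncomputable def cpl {Y : Type*} [MeasurableSpace Y] (f : Y × Y → ℝ≥0∞) (μ ν : Measure Y) :
    Measure (Y × Y) :=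
  (μ.prod ν).withDensity (full (nrm f μ ν) μ ν)

section
variable {Y : Type*} [MeasurableSpace Y]

lemma nrm_measurable {f : Y × Y → ℝ≥0∞} (hf : Measurable f) (μ ν : Measure Y)
    [IsProbabilityMeasure μ] [IsProbabilityMeasure ν] : Measurable (nrm f μ ν) := by
  unfold nrm
  have h1 : Measurable fun y => ∫⁻ z, f (y, z) ∂ν := hf.lintegral_prod_right'
  have h2 : Measurable fun z => ∫⁻ y, f (y, z) ∂μ := hf.lintegral_prod_left'
  have h1' : Measurable fun w : Y × Y => ∫⁻ z, f (w.1, z) ∂ν := h1.comp measurable_fst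
  have h2' : Measurable fun w : Y × Y => ∫⁻ y, f (y, w.2) ∂μ := h2.comp measurable_snd
  exact hf.div ((measurable_const.max h1').mul (measurable_const.max h2'))

lemma full_measurable {f : Y × Y → ℝ≥0∞} (hf : Measurable f) (μ ν : Measure Y)
    [IsProbabilityMeasure μ] [IsProbabilityMeasure ν] : Measurable (full f μ ν) := by
  unfold full
  have h1 : Measurable fun y => ∫⁻ z, f (y, z) ∂ν := hf.lintegral_prod_right'
  have h2 : Measurable fun z => ∫⁻ y, f (y, z) ∂μ := hf.lintegral_prod_left'
  have h1' : Measurable fun w : Y × Y => ∫⁻ z, f (w.1, z) ∂ν := h1.comp measurable_fst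
  have h2' : Measurable fun w : Y × Y => ∫⁻ y, f (y, w.2) ∂μ := h2.comp measurable_snd
  exact hf.add (((measurable_const.sub h1').mul (measurable_const.sub h2')).div measurable_const)

lemma nrm_le {f : Y × Y → ℝ≥0∞} (μ ν : Measure Y) (y z : Y) :
    nrm f μ ν (y, z) ≤ f (y, z) * (max 1 (∫⁻ z, f (y, z) ∂ν))⁻¹ := by
  unfold nrm
  rw [ENNReal.div_eq_inv_mul, mul_comm]
  gcongr
  exact le_mul_of_one_le_right (by simp) (le_max_left _ _)

lemma nrm_swap (f : Y × Y → ℝ≥0∞) (μ ν : Measure Y) (y z : Y) :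
    nrm (f ∘ Prod.swap) ν μ (z, y) = nrm f μ ν (y, z) := by
  simp [nrm, mul_comm]

lemma nrm_marg {f : Y × Y → ℝ≥0∞} (hf : Measurable f) (μ ν : Measure Y) (y : Y) :
    ∫⁻ z, nrm f μ ν (y, z) ∂ν ≤ 1 := by
  calc _ ≤ ∫⁻ z, f (y, z) * (max 1 (∫⁻ z, f (y, z) ∂ν))⁻¹ ∂ν :=
        lintegral_mono fun z => nrm_le μ ν y z
    _ = (∫⁻ z, f (y, z) ∂ν) * (max 1 (∫⁻ z, f (y, z) ∂ν))⁻¹ :=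
        lintegral_mul_const _ (by fun_prop)
    _ ≤ (max 1 (∫⁻ z, f (y, z) ∂ν)) * (max 1 (∫⁻ z, f (y, z) ∂ν))⁻¹ := by
        gcongr; exact le_max_right _ _
    _ ≤ 1 := ENNReal.mul_inv_le_one _

lemma nrm_marg' {f : Y × Y → ℝ≥0∞} (hf : Measurable f) (μ ν : Measure Y) (z : Y) :
    ∫⁻ y, nrm f μ ν (y, z) ∂μ ≤ 1 := by
  have := nrm_marg (hf.comp measurable_swap) ν μ z
  simpa only [nrm_swap] using this

lemma nrm_eq {f : Y × Y → ℝ≥0∞} (μ ν : Measure Y)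
    (h1 : ∀ y, ∫⁻ z, f (y, z) ∂ν ≤ 1) (h2 : ∀ z, ∫⁻ y, f (y, z) ∂μ ≤ 1) :
    nrm f μ ν = f := by
  ext w
  simp [nrm, max_eq_left (h1 _), max_eq_left (h2 _)]

lemma resid_int {f : Y × Y → ℝ≥0∞} (hf : Measurable f) (μ ν : Measure Y)
    [IsProbabilityMeasure μ] [IsProbabilityMeasure ν]
    (h2 : ∀ y, ∫⁻ z, f (y, z) ∂ν ≤ 1) :
    ∫⁻ y, (1 - ∫⁻ z, f (y, z) ∂ν) ∂μ = 1 - ∫⁻ y, ∫⁻ z, f (y, z) ∂ν ∂μ := by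
  have h1 : Measurable fun y => ∫⁻ z, f (y, z) ∂ν := hf.lintegral_prod_right'
  have hle : ∫⁻ y, ∫⁻ z, f (y, z) ∂ν ∂μ ≤ 1 := by
    calc _ ≤ ∫⁻ y, 1 ∂μ := lintegral_mono h2
      _ = 1 := by simp
  rw [lintegral_sub h1 (ne_top_of_le_ne_top (by simp) hle) (Eventually.of_forall h2)]
  simp

lemma resid_int' {f : Y × Y → ℝ≥0∞} (hf : Measurable f) (μ ν : Measure Y)
    [IsProbabilityMeasure μ] [IsProbabilityMeasure ν]
    (h2 : ∀ z, ∫⁻ y, f (y, z) ∂μ ≤ 1) :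
    ∫⁻ z, (1 - ∫⁻ y, f (y, z) ∂μ) ∂ν = 1 - ∫⁻ y, ∫⁻ z, f (y, z) ∂ν ∂μ := by
  have := resid_int (hf.comp measurable_swap) ν μ h2
  simp only [Function.comp, Prod.swap_prod_mk] at this
  rw [this, lintegral_lintegral_swap]
  exact (hf.comp measurable_swap).aemeasurable

lemma full_marg {f : Y × Y → ℝ≥0∞} (hf : Measurable f) (μ ν : Measure Y)
    [IsProbabilityMeasure μ] [IsProbabilityMeasure ν]
    (h1 : ∀ y, ∫⁻ z, f (y, z) ∂ν ≤ 1) (h2 : ∀ z, ∫⁻ y, f (y, z) ∂μ ≤ 1) :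
    ∀ᵐ y ∂μ, ∫⁻ z, full f μ ν (y, z) ∂ν = 1 := by
  have m1 : Measurable fun y => ∫⁻ z, f (y, z) ∂ν := hf.lintegral_prod_right'
  have m2 : Measurable fun z => ∫⁻ y, f (y, z) ∂μ := hf.lintegral_prod_left'
  set m := 1 - ∫⁻ y, ∫⁻ z, f (y, z) ∂ν ∂μ with hm
  have key : ∀ y, ∫⁻ z, full f μ ν (y, z) ∂ν
      = (∫⁻ z, f (y, z) ∂ν) + (1 - ∫⁻ z, f (y, z) ∂ν) * (m * m⁻¹) := by
    intro y
    unfold full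
    rw [lintegral_add_left (by fun_prop)]
    congr 1
    simp only [← hm, div_eq_mul_inv, mul_assoc]
    rw [lintegral_const_mul _ (by fun_prop), lintegral_mul_const _ (by fun_prop),
      resid_int' hf μ ν h2]
  simp only [key]
  have hmt : m ≠ ∞ := ne_top_of_le_ne_top ENNReal.one_ne_top tsub_le_self
  by_cases h0 : m = 0
  · have := resid_int hf μ ν h1
    rw [← hm, h0, lintegral_eq_zero_iff (by fun_prop)] at this
    filter_upwards [this] with y hy
    simp only [Pi.zero_apply] at hy
    rw [hy, zero_mul, add_zero]
    exact le_antisymm (h1 y) (tsub_eq_zero_iff_le.mp hy)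
  · refine Eventually.of_forall fun y => ?_
    rw [ENNReal.mul_inv_cancel h0 hmt, mul_one, add_tsub_cancel_of_le (h1 y)]

lemma full_swap {f : Y × Y → ℝ≥0∞} (hf : Measurable f) (μ ν : Measure Y)
    [IsProbabilityMeasure μ] [IsProbabilityMeasure ν] (y z : Y) :
    full (f ∘ Prod.swap) ν μ (z, y) = full f μ ν (y, z) := by
  have : ∫⁻ z, ∫⁻ y, f (y, z) ∂μ ∂ν = ∫⁻ y, ∫⁻ z, f (y, z) ∂ν ∂μ :=
    lintegral_lintegral_swap (hf.comp measurable_swap).aemeasurable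
  simp [full, mul_comm, this]

lemma full_marg' {f : Y × Y → ℝ≥0∞} (hf : Measurable f) (μ ν : Measure Y)
    [IsProbabilityMeasure μ] [IsProbabilityMeasure ν]
    (h1 : ∀ y, ∫⁻ z, f (y, z) ∂ν ≤ 1) (h2 : ∀ z, ∫⁻ y, f (y, z) ∂μ ≤ 1) :
    ∀ᵐ z ∂ν, ∫⁻ y, full f μ ν (y, z) ∂μ = 1 := by
  have := full_marg (hf.comp measurable_swap) ν μ h2 h1
  simpa only [full_swap hf] using this

lemma map_fst_of_marg {F : Y × Y → ℝ≥0∞} (hF : Measurable F) (μ ν : Measure Y)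
    [IsProbabilityMeasure μ] [IsProbabilityMeasure ν]
    (h : ∀ᵐ y ∂μ, ∫⁻ z, F (y, z) ∂ν = 1) :
    ((μ.prod ν).withDensity F).map Prod.fst = μ := by
  refine Measure.ext_of_lintegral _ fun u hu => ?_
  rw [lintegral_map hu measurable_fst, lintegral_withDensity_eq_lintegral_mul _ hF (by fun_prop),
    lintegral_prod _ (by fun_prop)]
  refine lintegral_congr_ae ?_
  filter_upwards [h] with y hy
  simp only [Pi.mul_apply]
  rw [lintegral_mul_const _ (by fun_prop), hy, one_mul]

lemma map_snd_of_marg {F : Y × Y → ℝ≥0∞} (hF : Measurable F) (μ ν : Measure Y)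
    [IsProbabilityMeasure μ] [IsProbabilityMeasure ν]
    (h : ∀ᵐ z ∂ν, ∫⁻ y, F (y, z) ∂μ = 1) :
    ((μ.prod ν).withDensity F).map Prod.snd = ν := by
  refine Measure.ext_of_lintegral _ fun u hu => ?_
  rw [lintegral_map hu measurable_snd, lintegral_withDensity_eq_lintegral_mul _ hF (by fun_prop),
    lintegral_prod_symm _ (by fun_prop)]
  refine lintegral_congr_ae ?_
  filter_upwards [h] with y hy
  simp only [Pi.mul_apply]
  rw [lintegral_mul_const _ (by fun_prop), hy, one_mul]

lemma cpl_fst {f : Y × Y → ℝ≥0∞} (hf : Measurable f) (μ ν : Measure Y)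
    [IsProbabilityMeasure μ] [IsProbabilityMeasure ν] : (cpl f μ ν).map Prod.fst = μ :=
  map_fst_of_marg (full_measurable (nrm_measurable hf μ ν) μ ν) μ ν
    (full_marg (nrm_measurable hf μ ν) μ ν (nrm_marg hf μ ν) (nrm_marg' hf μ ν))

lemma cpl_snd {f : Y × Y → ℝ≥0∞} (hf : Measurable f) (μ ν : Measure Y)
    [IsProbabilityMeasure μ] [IsProbabilityMeasure ν] : (cpl f μ ν).map Prod.snd = ν :=
  map_snd_of_marg (full_measurable (nrm_measurable hf μ ν) μ ν) μ ν
    (full_marg' (nrm_measurable hf μ ν) μ ν (nrm_marg hf μ ν) (nrm_marg' hf μ ν))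

/-- Cost bound for the coupling built from a sub-coupling density. -/
lemma cpl_cost {f : Y × Y → ℝ≥0∞} (hf : Measurable f) (μ ν : Measure Y)
    [IsProbabilityMeasure μ] [IsProbabilityMeasure ν]
    (h1 : ∀ y, ∫⁻ z, f (y, z) ∂ν ≤ 1) (h2 : ∀ z, ∫⁻ y, f (y, z) ∂μ ≤ 1)
    {c : Y × Y → ℝ≥0∞} (hc : Measurable c) {s : Y → ℝ≥0∞} (hs : Measurable s)
    (hcs : ∀ y z, c (y, z) ≤ s y + s z) :
    ∫⁻ w, c w ∂(cpl f μ ν) ≤ ∫⁻ w, c w * f w ∂(μ.prod ν)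
      + ((∫⁻ y, (1 - ∫⁻ z, f (y, z) ∂ν) * s y ∂μ) + ∫⁻ z, (1 - ∫⁻ y, f (y, z) ∂μ) * s z ∂ν) := by
  have m1 : Measurable fun y => ∫⁻ z, f (y, z) ∂ν := hf.lintegral_prod_right'
  have m2 : Measurable fun z => ∫⁻ y, f (y, z) ∂μ := hf.lintegral_prod_left'
  unfold cpl
  rw [nrm_eq μ ν h1 h2, lintegral_withDensity_eq_lintegral_mul _ (full_measurable hf μ ν) hc]
  set m := 1 - ∫⁻ y, ∫⁻ z, f (y, z) ∂ν ∂μ with hm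
  set g := fun y => 1 - ∫⁻ z, f (y, z) ∂ν with hg
  set h := fun z => 1 - ∫⁻ y, f (y, z) ∂μ with hh
  have mg : Measurable g := measurable_const.sub m1
  have mh : Measurable h := measurable_const.sub m2
  have ig : ∫⁻ y, g y ∂μ = m := resid_int hf μ ν h1
  have ih : ∫⁻ z, h z ∂ν = m := resid_int' hf μ ν h2
  calc ∫⁻ w, (full f μ ν * c) w ∂(μ.prod ν)
      ≤ ∫⁻ w, (c w * f w + ((g w.1 * s w.1) * (h w.2 * m⁻¹) + (g w.1 * m⁻¹) * (h w.2 * s w.2)))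
          ∂(μ.prod ν) := by
        refine lintegral_mono fun w => ?_
        have : full f μ ν w = f w + g w.1 * h w.2 * m⁻¹ := rfl
        rw [Pi.mul_apply, this, add_mul, mul_comm (f w)]
        gcongr
        calc g w.1 * h w.2 * m⁻¹ * c w ≤ g w.1 * h w.2 * m⁻¹ * (s w.1 + s w.2) := by
              gcongr; exact hcs _ _
          _ = _ := by ring
    _ = ∫⁻ w, c w * f w ∂(μ.prod ν) + ((∫⁻ y, g y * s y ∂μ) * (m * m⁻¹)
          + (m * m⁻¹) * (∫⁻ z, h z * s z ∂ν)) := by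
        rw [lintegral_add_left (by fun_prop), lintegral_add_left (by fun_prop),
          lintegral_prod_mul (f := fun y => g y * s y) (g := fun z => h z * m⁻¹) (by fun_prop) (by fun_prop),
          lintegral_prod_mul (f := fun y => g y * m⁻¹) (g := fun z => h z * s z) (by fun_prop) (by fun_prop),
          lintegral_mul_const _ mh, lintegral_mul_const _ mg, ig, ih]
    _ ≤ _ := by
        gcongr
        · exact mul_le_of_le_one_right (by simp) (ENNReal.mul_inv_le_one _)
        · exact mul_le_of_le_one_left (by simp) (ENNReal.mul_inv_le_one _)

/-- Measurable dependence of the coupling on a parameter. -/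
lemma exists_kernel {X : Type*} [MeasurableSpace X] (κ η : Kernel X Y) [IsMarkovKernel κ]
    [IsMarkovKernel η] {f : Y × Y → ℝ≥0∞} (hf : Measurable f) :
    ∃ θ : Kernel X (Y × Y), ∀ x, θ x = cpl f (κ x) (η x) := by
  have A : ∀ (ζ : Kernel X Y) [IsMarkovKernel ζ] (F : X × Y × Y → ℝ≥0∞), Measurable F →
      Measurable fun w : X × Y => ∫⁻ z, F (w.1, w.2, z) ∂(ζ w.1) := by
    intro ζ _ F hF
    exact Measurable.lintegral_kernel_prod_right' (κ := ζ.comap Prod.fst measurable_fst)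
      (f := fun u : (X × Y) × Y => F (u.1.1, u.1.2, u.2)) (by fun_prop)
  have mfull : ∀ F : X × Y × Y → ℝ≥0∞, Measurable F →
      Measurable fun u : X × Y × Y => full (fun w => F (u.1, w)) (κ u.1) (η u.1) u.2 := by
    intro F hF
    have a1 := (A η F hF).comp (f := fun u : X × Y × Y => (u.1, u.2.1)) (by fun_prop)
    have a2 := (A κ (fun u => F (u.1, u.2.2, u.2.1)) (by fun_prop)).comp
      (f := fun u : X × Y × Y => (u.1, u.2.2)) (by fun_prop)
    have a3 : Measurable fun u : X × Y × Y =>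
        ∫⁻ y, ∫⁻ z, F (u.1, y, z) ∂(η u.1) ∂(κ u.1) :=
      (Measurable.lintegral_kernel_prod_right' (κ := κ) (A η F hF)).comp measurable_fst
    exact hF.add (((measurable_const.sub a1).mul (measurable_const.sub a2)).div
      (measurable_const.sub a3))
  have mnrm : Measurable fun u : X × Y × Y => nrm f (κ u.1) (η u.1) u.2 := by
    have hF : Measurable fun u : X × Y × Y => f u.2 := hf.comp measurable_snd
    have a1 := (A η (fun u => f u.2) hF).comp (f := fun u : X × Y × Y => (u.1, u.2.1)) (by fun_prop)
    have a2 := (A κ (fun u => f (u.2.2, u.2.1)) (by fun_prop)).comp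
      (f := fun u : X × Y × Y => (u.1, u.2.2)) (by fun_prop)
    exact hF.div ((measurable_const.max a1).mul (measurable_const.max a2))
  refine ⟨(κ ×ₖ η).withDensity (fun x w => full (nrm f (κ x) (η x)) (κ x) (η x) w), fun x => ?_⟩
  rw [Kernel.withDensity_apply _ (mfull _ mnrm), Kernel.prod_apply]
  rfl

end

section

/-- Density of a coupling on a countable space w.r.t. the product of its marginals. -/
lemma exists_density (κ : Measure (ℕ × ℕ)) [IsFiniteMeasure κ] (α β : Measure ℕ)
    (hα : κ.map Prod.fst = α) (hβ : κ.map Prod.snd = β) :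
    ∃ ρ : ℕ × ℕ → ℝ≥0∞, (∀ w, ρ w ≠ ∞) ∧
      (∀ i, ∫⁻ j, ρ (i, j) ∂β ≤ 1) ∧ (∀ j, ∫⁻ i, ρ (i, j) ∂α ≤ 1) ∧
      (∀ i, α {i} ≠ 0 → ∫⁻ j, ρ (i, j) ∂β = 1) ∧ (∀ j, β {j} ≠ 0 → ∫⁻ i, ρ (i, j) ∂α = 1) ∧
      (α.prod β).withDensity ρ = κ := by
  have fα : IsFiniteMeasure α := by rw [← hα]; infer_instance
  have fβ : IsFiniteMeasure β := by rw [← hβ]; infer_instance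
  have aα : ∀ i, α {i} = ∑' j, κ {(i, j)} := by
    intro i
    rw [← hα, Measure.map_apply measurable_fst (measurableSet_singleton i)]
    have : (Prod.fst ⁻¹' {i} : Set (ℕ × ℕ)) = ⋃ j, {(i, j)} := by
      ext ⟨a, b⟩; simp [eq_comm]
    rw [this, measure_iUnion _ fun j => measurableSet_singleton _]
    intro a b hab
    simpa [Function.onFun] using hab
  have aβ : ∀ j, β {j} = ∑' i, κ {(i, j)} := by
    intro j
    rw [← hβ, Measure.map_apply measurable_snd (measurableSet_singleton j)]
    have : (Prod.snd ⁻¹' {j} : Set (ℕ × ℕ)) = ⋃ i, {(i, j)} := by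
      ext ⟨a, b⟩; simp [eq_comm]
    rw [this, measure_iUnion _ fun i => measurableSet_singleton _]
    intro a b hab
    simpa [Function.onFun] using hab
  have zα : ∀ i j, α {i} = 0 → κ {(i, j)} = 0 := by
    intro i j h
    rw [aα, ENNReal.tsum_eq_zero] at h
    exact h j
  have zβ : ∀ i j, β {j} = 0 → κ {(i, j)} = 0 := by
    intro i j h
    rw [aβ, ENNReal.tsum_eq_zero] at h
    exact h i
  set ρ : ℕ × ℕ → ℝ≥0∞ := fun w => κ {w} * (α {w.1})⁻¹ * (β {w.2})⁻¹ with hρ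
  have e1 : ∀ i j, ρ (i, j) * β {j} = κ {(i, j)} * (α {i})⁻¹ := by
    intro i j
    by_cases h : β {j} = 0
    · simp [h, zβ i j h]
    · simp only [hρ]
      rw [mul_assoc, ENNReal.inv_mul_cancel h (measure_ne_top _ _), mul_one]
  have e2 : ∀ i j, ρ (i, j) * α {i} = κ {(i, j)} * (β {j})⁻¹ := by
    intro i j
    by_cases h : α {i} = 0
    · simp [h, zα i j h]
    · simp only [hρ]
      rw [mul_right_comm, mul_assoc (κ _), ENNReal.inv_mul_cancel h (measure_ne_top _ _), mul_one]
  have i1 : ∀ i, ∫⁻ j, ρ (i, j) ∂β = α {i} * (α {i})⁻¹ := by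
    intro i
    rw [lintegral_countable']
    simp only [e1]
    rw [ENNReal.tsum_mul_right, ← aα]
  have i2 : ∀ j, ∫⁻ i, ρ (i, j) ∂α = β {j} * (β {j})⁻¹ := by
    intro j
    rw [lintegral_countable']
    simp only [e2]
    rw [ENNReal.tsum_mul_right, ← aβ]
  refine ⟨ρ, ?_, ?_, ?_, ?_, ?_, ?_⟩
  · rintro ⟨i, j⟩
    by_cases h : α {i} = 0
    · simp [hρ, zα i j h]
    by_cases h' : β {j} = 0
    · simp [hρ, zβ i j h']
    exact ENNReal.mul_ne_top (ENNReal.mul_ne_top (measure_ne_top _ _) (ENNReal.inv_ne_top.2 h))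
      (ENNReal.inv_ne_top.2 h')
  · intro i; rw [i1]; exact ENNReal.mul_inv_le_one _
  · intro i; rw [i2]; exact ENNReal.mul_inv_le_one _
  · intro i h; rw [i1]; exact ENNReal.mul_inv_cancel h (measure_ne_top _ _)
  · intro i h; rw [i2]; exact ENNReal.mul_inv_cancel h (measure_ne_top _ _)
  · refine Measure.ext_of_singleton fun w => ?_
    obtain ⟨i, j⟩ := w
    rw [withDensity_apply _ (measurableSet_singleton _), lintegral_singleton,
      ← Set.singleton_prod_singleton, Measure.prod_prod, mul_comm (α _), ← mul_assoc, e1,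
      Set.singleton_prod_singleton]
    by_cases h : α {i} = 0
    · simp [h, zα i j h]
    · rw [mul_assoc, ENNReal.inv_mul_cancel h (measure_ne_top _ _), mul_one]

/-- Approximation from below by finitely supported rational matrices. -/
lemma exists_approx (ρ : ℕ × ℕ → ℝ≥0∞) (hρ : ∀ w, ρ w ≠ ∞) :
    ∃ r : ℕ → (ℕ × ℕ →₀ ℕ), (∀ n w, (r n w : ℝ≥0∞) / (n + 1 : ℕ) ≤ ρ w) ∧
      ∀ w, Tendsto (fun n => (r n w : ℝ≥0∞) / (n + 1 : ℕ)) atTop (𝓝 (ρ w)) := by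
  classical
  have eqv : ∀ (k n : ℕ), (k : ℝ≥0∞) / (n + 1 : ℕ) = ENNReal.ofReal ((k : ℝ) / (n + 1 : ℕ)) := by
    intro k n
    rw [ENNReal.ofReal_div_of_pos (by positivity), ENNReal.ofReal_natCast, ENNReal.ofReal_natCast]
  let r : ℕ → (ℕ × ℕ →₀ ℕ) := fun n => Finsupp.onFinset (Finset.range n ×ˢ Finset.range n)
    (fun w => if w.1 < n ∧ w.2 < n then ⌊(ρ w).toReal * (n + 1 : ℕ)⌋₊ else 0) (by
      intro w hw
      by_contra h
      simp only [Finset.mem_product, Finset.mem_range] at h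
      simp [h] at hw)
  have rap : ∀ n w, r n w = if w.1 < n ∧ w.2 < n then ⌊(ρ w).toReal * (n + 1 : ℕ)⌋₊ else 0 :=
    fun n w => rfl
  refine ⟨r, ?_, ?_⟩
  · intro n w
    rw [eqv, rap]
    refine ENNReal.ofReal_le_of_le_toReal ?_
    rw [div_le_iff₀ (by positivity)]
    split_ifs
    · exact Nat.floor_le (by positivity)
    · simp only [Nat.cast_zero]; positivity
  · intro w
    rw [← ENNReal.ofReal_toReal (hρ w)]
    simp only [eqv]
    refine ENNReal.tendsto_ofReal ?_
    have h1 : Tendsto (fun x : ℝ => (⌊(ρ w).toReal * x⌋₊ : ℝ) / x) atTop (𝓝 (ρ w).toReal) :=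
      tendsto_nat_floor_mul_div_atTop ENNReal.toReal_nonneg
    have h2 : Tendsto (fun n : ℕ => ((n + 1 : ℕ) : ℝ)) atTop atTop :=
      tendsto_natCast_atTop_atTop.comp (tendsto_add_atTop_nat 1)
    refine (h1.comp h2).congr' ?_
    filter_upwards [eventually_gt_atTop w.1, eventually_gt_atTop w.2] with n a b
    simp [rap, a, b]

variable {Y : Type*} [MetricSpace Y] [PolishSpace Y] [MeasurableSpace Y] [BorelSpace Y]

lemma exists_cell [Nonempty Y] (k : ℕ) :
    ∃ T : Y → ℕ, Measurable T ∧
      ∀ y, edist y (TopologicalSpace.denseSeq Y (T y)) ≤ ENNReal.ofReal (1 / (k + 1)) := by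
  classical
  have hex : ∀ y : Y, ∃ n, dist y (TopologicalSpace.denseSeq Y n) < 1 / ((k : ℝ) + 1) := by
    intro y
    exact (TopologicalSpace.denseRange_denseSeq Y).exists_dist_lt y (by positivity)
  refine ⟨fun y => Nat.find (hex y), ?_, ?_⟩
  · refine measurable_find hex fun n => ?_
    exact measurableSet_lt (by fun_prop) measurable_const
  · intro y
    rw [edist_dist]
    exact ENNReal.ofReal_le_ofReal (Nat.find_spec (hex y)).le

/-- The cell maps. -/
noncomputable def cell [Nonempty Y] (k : ℕ) : Y → ℕ := (exists_cell (Y := Y) k).choose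

/-- The countable family of densities. -/
noncomputable def fam [Nonempty Y] (i : ℕ × ℕ × (ℕ × ℕ →₀ ℕ)) : Y × Y → ℝ≥0∞ :=
  fun w => (i.2.2 (cell i.1 w.1, cell i.1 w.2) : ℝ≥0∞) / (i.2.1 + 1 : ℕ)

lemma cell_measurable [Nonempty Y] (k : ℕ) : Measurable (cell (Y := Y) k) :=
  (exists_cell (Y := Y) k).choose_spec.1

lemma cell_dist [Nonempty Y] (k : ℕ) (y : Y) :
    edist y (TopologicalSpace.denseSeq Y (cell k y)) ≤ ENNReal.ofReal (1 / (k + 1)) :=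
  (exists_cell (Y := Y) k).choose_spec.2 y

lemma fam_measurable [Nonempty Y] (i : ℕ × ℕ × (ℕ × ℕ →₀ ℕ)) : Measurable (fam (Y := Y) i) := by
  unfold fam
  have : Measurable fun w : Y × Y => (cell i.1 w.1, cell i.1 w.2) :=
    ((cell_measurable i.1).comp measurable_fst).prodMk ((cell_measurable i.1).comp measurable_snd)
  exact (Measurable.of_discrete (f := fun w : ℕ × ℕ => (i.2.2 w : ℝ≥0∞) / (i.2.1 + 1 : ℕ))).comp
    this

end

section
variable {Y : Type*} [MetricSpace Y] [PolishSpace Y] [MeasurableSpace Y] [BorelSpace Y]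

lemma edist_rpow_le {p : ℝ} (hp : 1 ≤ p) (y₀ y z : Y) :
    edist y z ^ p ≤ 2 ^ (p - 1) * edist y y₀ ^ p + 2 ^ (p - 1) * edist z y₀ ^ p := by
  rw [← mul_add]
  calc edist y z ^ p ≤ (edist y y₀ + edist z y₀) ^ p := by
        gcongr
        rw [edist_comm z y₀]; exact edist_triangle _ _ _
    _ ≤ _ := ENNReal.rpow_add_le_mul_rpow_add_rpow _ _ hp

lemma two_rpow_ne_top (q : ℝ) : (2 : ℝ≥0∞) ^ q ≠ ∞ := by
  simp [ENNReal.rpow_eq_top_iff]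

lemma coupling_cost_le {p : ℝ} (hp : 1 ≤ p) (y₀ : Y) (μ ν : Measure Y) (π : Measure (Y × Y))
    (h1 : π.map Prod.fst = μ) (h2 : π.map Prod.snd = ν) :
    ∫⁻ w, edist w.1 w.2 ^ p ∂π ≤ 2 ^ (p - 1) * (∫⁻ y, edist y y₀ ^ p ∂μ)
      + 2 ^ (p - 1) * (∫⁻ y, edist y y₀ ^ p ∂ν) := by
  calc ∫⁻ w, edist w.1 w.2 ^ p ∂π
      ≤ ∫⁻ w, (2 ^ (p - 1) * edist w.1 y₀ ^ p + 2 ^ (p - 1) * edist w.2 y₀ ^ p) ∂π :=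
        lintegral_mono fun w => edist_rpow_le hp _ _ _
    _ = _ := by
        rw [lintegral_add_left (by fun_prop), lintegral_const_mul _ (by fun_prop),
          lintegral_const_mul _ (by fun_prop), ← h1, ← h2,
          lintegral_map (by fun_prop) measurable_fst, lintegral_map (by fun_prop) measurable_snd]

/-- The block approximation step. -/
lemma exists_block [Nonempty Y] {p : ℝ} (hp : 1 ≤ p) (k : ℕ) (μ ν : Measure Y)
    [IsProbabilityMeasure μ] [IsProbabilityMeasure ν] (π : Measure (Y × Y))
    (h1 : π.map Prod.fst = μ) (h2 : π.map Prod.snd = ν) :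
    ∃ ρ : ℕ × ℕ → ℝ≥0∞, (∀ w, ρ w ≠ ∞) ∧
      (∀ y : Y, ∫⁻ z : Y, ρ (cell k y, cell k z) ∂ν ≤ 1) ∧
      (∀ z : Y, ∫⁻ y : Y, ρ (cell k y, cell k z) ∂μ ≤ 1) ∧
      (∀ᵐ y ∂μ, ∫⁻ z : Y, ρ (cell k y, cell k z) ∂ν = 1) ∧
      (∀ᵐ z ∂ν, ∫⁻ y : Y, ρ (cell k y, cell k z) ∂μ = 1) ∧
      ∫⁻ w : Y × Y, edist w.1 w.2 ^ p * ρ (cell k w.1, cell k w.2) ∂(μ.prod ν)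
        ≤ ∫⁻ w, (edist w.1 w.2 + 4 * ENNReal.ofReal (1 / (k + 1))) ^ p ∂π := by
  have hT := cell_measurable (Y := Y) k
  have hp0 : 0 ≤ p := by linarith
  have hπ : IsProbabilityMeasure π := by
    constructor
    have : π.map Prod.fst Set.univ = 1 := by rw [h1]; simp
    rwa [Measure.map_apply measurable_fst MeasurableSet.univ] at this
  have hTT : Measurable fun w : Y × Y => (cell k w.1, cell k w.2) :=
    (hT.comp measurable_fst).prodMk (hT.comp measurable_snd)
  obtain ⟨ρ, hfin, a1, a2, a3, a4, hρ⟩ := exists_density (π.map fun w => (cell k w.1, cell k w.2))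
    (μ.map (cell k)) (ν.map (cell k))
    (by rw [Measure.map_map measurable_fst hTT, ← h1, Measure.map_map hT measurable_fst]; rfl)
    (by rw [Measure.map_map measurable_snd hTT, ← h2, Measure.map_map hT measurable_snd]; rfl)
  have c1 : ∀ y : Y, ∫⁻ z : Y, ρ (cell k y, cell k z) ∂ν
      = ∫⁻ j, ρ (cell k y, j) ∂(ν.map (cell k)) := fun y =>
    (lintegral_map (f := fun j => ρ (cell k y, j)) Measurable.of_discrete hT).symm
  have c2 : ∀ z : Y, ∫⁻ y : Y, ρ (cell k y, cell k z) ∂μ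
      = ∫⁻ i, ρ (i, cell k z) ∂(μ.map (cell k)) := fun z =>
    (lintegral_map (f := fun i => ρ (i, cell k z)) Measurable.of_discrete hT).symm
  have ae : ∀ μ' : Measure Y, ∀ᵐ y ∂μ', (μ'.map (cell k)) {cell k y} ≠ 0 := by
    intro μ'
    refine ae_of_ae_map (p := fun i => (μ'.map (cell k)) {i} ≠ 0) hT.aemeasurable ?_
    rw [ae_iff_of_countable]
    exact fun a ha => ha
  refine ⟨ρ, hfin, fun y => ?_, fun z => ?_, ?_, ?_, ?_⟩
  · rw [c1]; exact a1 _
  · rw [c2]; exact a2 _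
  · filter_upwards [ae μ] with y hy
    rw [c1]; exact a3 _ hy
  · filter_upwards [ae ν] with y hy
    rw [c2]; exact a4 _ hy
  · set δ := ENNReal.ofReal (1 / (k + 1)) with hδ
    set q := TopologicalSpace.denseSeq Y with hq
    set G : ℕ × ℕ → ℝ≥0∞ := fun v => (edist (q v.1) (q v.2) + 2 * δ) ^ p with hG
    have mG : Measurable G := Measurable.of_discrete
    have mρ : Measurable ρ := Measurable.of_discrete
    calc ∫⁻ w : Y × Y, edist w.1 w.2 ^ p * ρ (cell k w.1, cell k w.2) ∂(μ.prod ν)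
        ≤ ∫⁻ w : Y × Y, (ρ * G) (cell k w.1, cell k w.2) ∂(μ.prod ν) := by
          refine lintegral_mono fun w => ?_
          simp only [Pi.mul_apply]
          rw [mul_comm]
          gcongr
          simp only [hG]
          gcongr
          calc edist w.1 w.2 ≤ edist w.1 (q (cell k w.1)) + edist (q (cell k w.1)) (q (cell k w.2))
                + edist (q (cell k w.2)) w.2 := edist_triangle4 _ _ _ _
            _ ≤ δ + edist (q (cell k w.1)) (q (cell k w.2)) + δ := by
              gcongr
              · exact cell_dist k _
              · rw [edist_comm]; exact cell_dist k _
            _ = _ := by ring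
      _ = ∫⁻ v, (ρ * G) v ∂((μ.prod ν).map (Prod.map (cell k) (cell k))) := by
          rw [lintegral_map (mρ.mul mG) (hT.prodMap hT)]; rfl
      _ = ∫⁻ v, G v ∂(π.map fun w => (cell k w.1, cell k w.2)) := by
          rw [← Measure.map_prod_map _ _ hT hT,
            ← lintegral_withDensity_eq_lintegral_mul _ mρ mG, hρ]
      _ = ∫⁻ w, G (cell k w.1, cell k w.2) ∂π := lintegral_map mG hTT
      _ ≤ _ := by
          refine lintegral_mono fun w => ?_
          simp only [hG]
          refine ENNReal.rpow_le_rpow ?_ hp0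
          calc edist (q (cell k w.1)) (q (cell k w.2)) + 2 * δ
              ≤ (edist (q (cell k w.1)) w.1 + edist w.1 w.2 + edist w.2 (q (cell k w.2))) + 2 * δ := by
                gcongr; exact edist_triangle4 _ _ _ _
            _ ≤ (δ + edist w.1 w.2 + δ) + 2 * δ := by
              gcongr
              · rw [edist_comm]; exact cell_dist k _
              · exact cell_dist k _
            _ = _ := by ring

set_option maxHeartbeats 1000000 in
/-- Key lemma: the countable family contains nearly optimal couplings. -/
lemma exists_fam [Nonempty Y] {p : ℝ} (hp : 1 ≤ p) (y₀ : Y) (μ ν : Measure Y)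
    [IsProbabilityMeasure μ] [IsProbabilityMeasure ν]
    (mμ : ∫⁻ y, edist y y₀ ^ p ∂μ ≠ ∞) (mν : ∫⁻ y, edist y y₀ ^ p ∂ν ≠ ∞)
    (π : Measure (Y × Y)) (h1 : π.map Prod.fst = μ) (h2 : π.map Prod.snd = ν)
    {ε : ℝ≥0∞} (hε : ε ≠ 0) :
    ∃ i, ∫⁻ w, edist w.1 w.2 ^ p ∂(cpl (fam i) μ ν) ≤ ∫⁻ w, edist w.1 w.2 ^ p ∂π + ε := by
  have hp0 : 0 < p := by linarith
  have hπ : IsProbabilityMeasure π := by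
    constructor
    have : π.map Prod.fst Set.univ = 1 := by rw [h1]; simp
    rwa [Measure.map_apply measurable_fst MeasurableSet.univ] at this
  have hc : ∫⁻ w, edist w.1 w.2 ^ p ∂π ≠ ∞ := by
    refine ne_top_of_le_ne_top ?_ (coupling_cost_le hp y₀ μ ν π h1 h2)
    exact ENNReal.add_ne_top.2 ⟨ENNReal.mul_ne_top (two_rpow_ne_top _) mμ,
      ENNReal.mul_ne_top (two_rpow_ne_top _) mν⟩
  have hε2 : ε / 2 ≠ 0 := by simpa using hε
  -- step 1
  have t0 : Tendsto (fun k : ℕ => 4 * ENNReal.ofReal (1 / ((k : ℝ) + 1))) atTop (𝓝 0) := by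
    have : Tendsto (fun k : ℕ => ENNReal.ofReal (1 / ((k : ℝ) + 1))) atTop (𝓝 0) := by
      simpa using ENNReal.tendsto_ofReal tendsto_one_div_add_atTop_nhds_zero_nat
    simpa using ENNReal.Tendsto.const_mul (a := 4) this (Or.inr (by simp))
  have t1 : Tendsto (fun k : ℕ => ∫⁻ w, (edist w.1 w.2 + 4 * ENNReal.ofReal (1 / ((k : ℝ) + 1))) ^ p ∂π)
      atTop (𝓝 (∫⁻ w, edist w.1 w.2 ^ p ∂π)) := by
    refine tendsto_lintegral_of_dominated_convergence (fun w => (edist w.1 w.2 + 4) ^ p)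
      (fun k => by fun_prop) (fun k => Eventually.of_forall fun w => ?_) ?_
      (Eventually.of_forall fun w => ?_)
    · dsimp only
      gcongr
      refine mul_le_of_le_one_right (by simp) ?_
      rw [ENNReal.ofReal_le_one, div_le_one (by positivity)]
      linarith [(Nat.cast_nonneg k : (0 : ℝ) ≤ k)]
    · refine ne_top_of_le_ne_top ?_ (lintegral_mono fun w : Y × Y =>
        ENNReal.rpow_add_le_mul_rpow_add_rpow (edist w.1 w.2) 4 hp)
      rw [lintegral_const_mul _ (by fun_prop), lintegral_add_left (by fun_prop)]
      refine ENNReal.mul_ne_top (two_rpow_ne_top _) (ENNReal.add_ne_top.2 ⟨hc, ?_⟩)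
      simp [ENNReal.rpow_eq_top_iff]
    · have := (tendsto_const_nhds (x := edist w.1 w.2)).add t0
      rw [add_zero] at this
      exact (ENNReal.continuous_rpow_const.tendsto _).comp this
  obtain ⟨k, hk⟩ := (t1.eventually (gt_mem_nhds (ENNReal.lt_add_right hc hε2))).exists
  obtain ⟨ρ, hfin, a1, a2, a3, a4, hρ⟩ := exists_block hp k μ ν π h1 h2
  obtain ⟨r, hr, hrt⟩ := exists_approx ρ hfin
  set s : Y → ℝ≥0∞ := fun y => 2 ^ (p - 1) * edist y y₀ ^ p with hs
  have ms : Measurable s := by fun_prop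
  have sμ : ∫⁻ y, s y ∂μ ≠ ∞ := by
    rw [lintegral_const_mul _ (by fun_prop)]; exact ENNReal.mul_ne_top (two_rpow_ne_top _) mμ
  have sν : ∫⁻ y, s y ∂ν ≠ ∞ := by
    rw [lintegral_const_mul _ (by fun_prop)]; exact ENNReal.mul_ne_top (two_rpow_ne_top _) mν
  have hsf : ∀ y, s y ≠ ∞ := fun y => ENNReal.mul_ne_top (two_rpow_ne_top _)
    (ENNReal.rpow_ne_top_of_nonneg hp0.le (edist_ne_top _ _))
  set f : ℕ → Y × Y → ℝ≥0∞ := fun n => fam (k, n, r n) with hf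
  have mf : ∀ n, Measurable (f n) := fun n => fam_measurable _
  have fle : ∀ n (y z : Y), f n (y, z) ≤ ρ (cell k y, cell k z) := fun n y z => hr n _
  have ft : ∀ y z : Y, Tendsto (fun n => f n (y, z)) atTop (𝓝 (ρ (cell k y, cell k z))) :=
    fun y z => hrt _
  have t2 : Tendsto (fun n => ∫⁻ y, (1 - ∫⁻ z, f n (y, z) ∂ν) * s y ∂μ) atTop (𝓝 0) := by
    have := tendsto_lintegral_of_dominated_convergence (μ := μ)
      (F := fun n y => (1 - ∫⁻ z, f n (y, z) ∂ν) * s y) (f := fun _ => 0) s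
      (fun n => (measurable_const.sub (mf n).lintegral_prod_right').mul ms)
      (fun n => Eventually.of_forall fun y => mul_le_of_le_one_left (by simp) tsub_le_self) sμ ?_
    · simpa using this
    filter_upwards [a3] with y hy
    have := tendsto_lintegral_of_dominated_convergence (μ := ν)
      (F := fun n z => f n (y, z)) (f := fun z => ρ (cell k y, cell k z))
      (fun z => ρ (cell k y, cell k z))
      (fun n => (mf n).comp measurable_prodMk_left)
      (fun n => Eventually.of_forall fun z => fle n y z)
      (by rw [hy]; simp) (Eventually.of_forall fun z => ft y z)
    rw [hy] at this
    have := ENNReal.Tendsto.sub (tendsto_const_nhds (x := (1 : ℝ≥0∞))) this (Or.inl (by simp))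
    simpa using ENNReal.Tendsto.mul_const (b := s y) this (Or.inr (hsf y))
  have t3 : Tendsto (fun n => ∫⁻ z, (1 - ∫⁻ y, f n (y, z) ∂μ) * s z ∂ν) atTop (𝓝 0) := by
    have := tendsto_lintegral_of_dominated_convergence (μ := ν)
      (F := fun n z => (1 - ∫⁻ y, f n (y, z) ∂μ) * s z) (f := fun _ => 0) s
      (fun n => (measurable_const.sub (mf n).lintegral_prod_left').mul ms)
      (fun n => Eventually.of_forall fun y => mul_le_of_le_one_left (by simp) tsub_le_self) sν ?_
    · simpa using this
    filter_upwards [a4] with z hz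
    have := tendsto_lintegral_of_dominated_convergence (μ := μ)
      (F := fun n y => f n (y, z)) (f := fun y => ρ (cell k y, cell k z))
      (fun y => ρ (cell k y, cell k z))
      (fun n => (mf n).comp measurable_prodMk_right)
      (fun n => Eventually.of_forall fun y => fle n y z)
      (by rw [hz]; simp) (Eventually.of_forall fun y => ft y z)
    rw [hz] at this
    have := ENNReal.Tendsto.sub (tendsto_const_nhds (x := (1 : ℝ≥0∞))) this (Or.inl (by simp))
    simpa using ENNReal.Tendsto.mul_const (b := s z) this (Or.inr (hsf z))
  have t4 := t2.add t3
  rw [add_zero] at t4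
  obtain ⟨n, hn⟩ := (t4.eventually (gt_mem_nhds (pos_iff_ne_zero.2 hε2))).exists
  refine ⟨(k, n, r n), ?_⟩
  calc ∫⁻ w, edist w.1 w.2 ^ p ∂(cpl (f n) μ ν)
      ≤ ∫⁻ w, edist w.1 w.2 ^ p * f n w ∂(μ.prod ν)
      + ((∫⁻ y, (1 - ∫⁻ z, f n (y, z) ∂ν) * s y ∂μ) + ∫⁻ z, (1 - ∫⁻ y, f n (y, z) ∂μ) * s z ∂ν) :=
        cpl_cost (mf n) μ ν (fun y => (lintegral_mono fun z => fle n y z).trans (a1 y))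
          (fun z => (lintegral_mono fun y => fle n y z).trans (a2 z))
          (c := fun w => edist w.1 w.2 ^ p) (by fun_prop) ms (fun y z => edist_rpow_le hp y₀ y z)
    _ ≤ (∫⁻ w, edist w.1 w.2 ^ p ∂π + ε / 2) + ε / 2 := by
        refine add_le_add ?_ hn.le
        refine le_trans (lintegral_mono fun w => ?_) (hρ.trans hk.le)
        dsimp only
        gcongr
        exact fle n w.1 w.2
    _ = _ := by rw [add_assoc, ENNReal.add_halves]

end

section
variable {Y : Type*} [MetricSpace Y] [PolishSpace Y] [MeasurableSpace Y] [BorelSpace Y]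

lemma ofReal_dist_rpow {p : ℝ} (hp : 1 ≤ p) (y z : Y) :
    ENNReal.ofReal (dist y z ^ p) = edist y z ^ p := by
  rw [edist_dist, ENNReal.ofReal_rpow_of_nonneg dist_nonneg (by linarith)]

lemma integral_dist {p : ℝ} (hp : 1 ≤ p) (π : Measure (Y × Y)) :
    ∫ w, dist w.1 w.2 ^ p ∂π = (∫⁻ w, edist w.1 w.2 ^ p ∂π).toReal := by
  rw [integral_eq_lintegral_of_nonneg_ae (Eventually.of_forall fun w => by positivity)
    (by fun_prop (disch := linarith))]
  simp only [ofReal_dist_rpow hp]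

lemma integrable_coupling {p : ℝ} (hp : 1 ≤ p) (y₀ : Y) (μ ν : Measure Y) (π : Measure (Y × Y))
    (h1 : π.map Prod.fst = μ) (h2 : π.map Prod.snd = ν)
    (mμ : ∫⁻ y, edist y y₀ ^ p ∂μ ≠ ∞) (mν : ∫⁻ y, edist y y₀ ^ p ∂ν ≠ ∞) :
    ∫⁻ w, edist w.1 w.2 ^ p ∂π ≠ ∞ ∧ Integrable (fun w => dist w.1 w.2 ^ p) π := by
  have hc : ∫⁻ w, edist w.1 w.2 ^ p ∂π ≠ ∞ := by
    refine ne_top_of_le_ne_top ?_ (coupling_cost_le hp y₀ μ ν π h1 h2)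
    exact ENNReal.add_ne_top.2 ⟨ENNReal.mul_ne_top (two_rpow_ne_top _) mμ,
      ENNReal.mul_ne_top (two_rpow_ne_top _) mν⟩
  refine ⟨hc, by fun_prop (disch := linarith), ?_⟩
  rw [hasFiniteIntegral_iff_ofReal (Eventually.of_forall fun w => by positivity)]
  simp only [ofReal_dist_rpow hp]
  exact lt_top_iff_ne_top.2 hc

lemma moment_ne_top {p : ℝ} (hp : 1 ≤ p) (y₀ : Y) (μ : Measure Y)
    (h : Integrable (fun y => dist y₀ y ^ p) μ) : ∫⁻ y, edist y y₀ ^ p ∂μ ≠ ∞ := by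
  have := h.lintegral_lt_top
  simp only [ofReal_dist_rpow hp] at this
  simp only [edist_comm _ y₀]
  exact this.ne

lemma wcost_nonneg (p : ℝ) (μ ν : Measure Y) :
    0 ≤ Wcost (fun x y => dist x y ^ p) μ ν := by
  refine Real.sInf_nonneg ?_
  rintro r ⟨π, -, -, rfl⟩
  exact integral_nonneg fun w => by positivity

lemma wcost_le {p : ℝ} (hp : 1 ≤ p) (μ ν : Measure Y) (π : Measure (Y × Y))
    (h1 : π.map Prod.fst = μ) (h2 : π.map Prod.snd = ν) :
    Wcost (fun x y => dist x y ^ p) μ ν ≤ (∫⁻ w, edist w.1 w.2 ^ p ∂π).toReal := by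
  refine csInf_le ⟨0, ?_⟩ ⟨π, h1, h2, (integral_dist hp π).symm⟩
  rintro r ⟨π, -, -, rfl⟩
  exact integral_nonneg fun w => by positivity

lemma exists_fam_wcost [Nonempty Y] {p : ℝ} (hp : 1 ≤ p) (y₀ : Y) (μ ν : Measure Y)
    [IsProbabilityMeasure μ] [IsProbabilityMeasure ν]
    (mμ : ∫⁻ y, edist y y₀ ^ p ∂μ ≠ ∞) (mν : ∫⁻ y, edist y y₀ ^ p ∂ν ≠ ∞)
    {ε : ℝ} (hε : 0 < ε) :
    ∃ i, ∫⁻ w, edist w.1 w.2 ^ p ∂(cpl (fam i) μ ν) ≤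
      ENNReal.ofReal (Wcost (fun x y => dist x y ^ p) μ ν) + ENNReal.ofReal ε := by
  have hne : {r : ℝ | ∃ π : Measure (Y × Y), π.map Prod.fst = μ ∧ π.map Prod.snd = ν ∧
      r = ∫ z, dist z.1 z.2 ^ p ∂π}.Nonempty := by
    refine ⟨_, μ.prod ν, ?_, ?_, rfl⟩
    · simp [Measure.map_fst_prod]
    · simp [Measure.map_snd_prod]
  obtain ⟨r, ⟨π, h1, h2, rfl⟩, hr⟩ := exists_lt_of_csInf_lt hne
    (lt_add_of_pos_right (Wcost (fun x y => dist x y ^ p) μ ν) (half_pos hε))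
  obtain ⟨i, hi⟩ := exists_fam hp y₀ μ ν mμ mν π h1 h2 (ε := ENNReal.ofReal (ε / 2))
    (by simpa using hε)
  refine ⟨i, hi.trans ?_⟩
  rw [integral_dist hp] at hr
  have hc := (integrable_coupling hp y₀ μ ν π h1 h2 mμ mν).1
  have : ∫⁻ w, edist w.1 w.2 ^ p ∂π
      ≤ ENNReal.ofReal (Wcost (fun x y => dist x y ^ p) μ ν) + ENNReal.ofReal (ε / 2) := by
    rw [← ENNReal.ofReal_add (wcost_nonneg p μ ν) (half_pos hε).le]
    exact (ENNReal.le_ofReal_iff_toReal_le hc (by linarith [wcost_nonneg p μ ν])).2 hr.le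
  calc _ ≤ _ := add_le_add_left this _
    _ = _ := by rw [add_assoc, ← ENNReal.ofReal_add (by linarith) (by linarith), add_halves]

end

section
variable {X Y : Type*} [MetricSpace X] [PolishSpace X] [MeasurableSpace X] [BorelSpace X]
  [MetricSpace Y] [PolishSpace Y] [MeasurableSpace Y] [BorelSpace Y]

lemma semidirect_eq (lam : Measure X) [IsProbabilityMeasure lam] (κ : Kernel X Y)
    [IsMarkovKernel κ] : semidirect lam κ = lam ⊗ₘ κ := by
  rw [Measure.compProd_eq_comp_prod]
  unfold semidirect
  congr 1
  funext x
  rw [Kernel.prod_apply, Kernel.id_apply, Measure.dirac_prod]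

lemma mix_eq (lam : Measure X) [IsProbabilityMeasure lam] (κ : Kernel X Y)
    [IsMarkovKernel κ] : (lam ⊗ₘ κ).map Prod.snd = mix lam κ :=
  Measure.snd_compProd lam κ

lemma mix_moment {p : ℝ} (hp : 1 ≤ p) (lam : Measure X) (hlam : MemPp p lam) (κ : Kernel X Y)
    (hκ : MemQp p κ) (y₁ : Y) : ∫⁻ x, ∫⁻ y, edist y y₁ ^ p ∂(κ x) ∂lam ≠ ∞ := by
  have hl := hlam.1
  obtain ⟨hk1, -, hk3, x₀, y₀, C, hC, hb⟩ := hκ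
  have hmk : IsMarkovKernel κ := ⟨hk1⟩
  have h0 : ∫⁻ x, ∫⁻ y, edist y y₀ ^ p ∂(κ x) ∂lam ≠ ∞ := by
    have hgrow : Integrable (fun x => C * (1 + dist x x₀ ^ p)) lam := by
      have := hlam.2 x₀
      simp only [dist_comm x₀] at this
      exact ((integrable_const 1).add this).const_mul C
    refine ne_top_of_le_ne_top hgrow.lintegral_lt_top.ne (lintegral_mono fun x => ?_)
    have hx := hb x
    rw [integral_eq_lintegral_of_nonneg_ae (Eventually.of_forall fun w => by positivity)
      (by fun_prop (disch := linarith))] at hx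
    simp only [ofReal_dist_rpow hp] at hx
    exact (ENNReal.le_ofReal_iff_toReal_le (moment_ne_top hp y₀ _ (hk3 x y₀)) (by positivity)).2 hx
  have hle : ∀ x, ∫⁻ y, edist y y₁ ^ p ∂(κ x)
      ≤ 2 ^ (p - 1) * (∫⁻ y, edist y y₀ ^ p ∂(κ x)) + 2 ^ (p - 1) * edist y₁ y₀ ^ p := by
    intro x
    calc _ ≤ ∫⁻ y, (2 ^ (p - 1) * edist y y₀ ^ p + 2 ^ (p - 1) * edist y₁ y₀ ^ p) ∂(κ x) :=
          lintegral_mono fun y => edist_rpow_le hp y₀ y y₁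
      _ = _ := by
          rw [lintegral_add_left (by fun_prop), lintegral_const_mul _ (by fun_prop)]; simp
  refine ne_top_of_le_ne_top ?_ (lintegral_mono hle)
  have hm : Measurable fun x => ∫⁻ y, edist y y₀ ^ p ∂(κ x) :=
    Measurable.lintegral_kernel (by fun_prop)
  rw [lintegral_add_left (by fun_prop), lintegral_const_mul _ hm]
  refine ENNReal.add_ne_top.2 ⟨ENNReal.mul_ne_top (two_rpow_ne_top _) h0, ?_⟩
  simp only [lintegral_const, measure_univ, mul_one]
  exact ENNReal.mul_ne_top (two_rpow_ne_top _)
    (ENNReal.rpow_ne_top_of_nonneg (by linarith) (edist_ne_top _ _))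

/-- The first inequality at the level of costs. -/
lemma first_ineq {p : ℝ} (hp : 1 ≤ p) (lam : Measure X) (hlam : MemPp p lam) (κ η : Kernel X Y)
    (hκ : MemQp p κ) (hη : MemQp p η) {ε : ℝ} (hε : 0 < ε) :
    Wcost (fun z w => dist z.1 w.1 ^ p + dist z.2 w.2 ^ p) (lam ⊗ₘ κ) (lam ⊗ₘ η) ≤
      (∫ x, Wcost (fun y z => dist y z ^ p) (κ x) (η x) ∂lam) + ε := by
  classical
  have hp0 : 0 < p := by linarith
  have hl := hlam.1
  have mκ := mix_moment hp lam hlam κ hκ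
  have mη := mix_moment hp lam hlam η hη
  obtain ⟨hk1, -, hk3, x₀, y₀, -, -, -⟩ := hκ
  obtain ⟨he1, -, he3, -⟩ := hη
  have : IsMarkovKernel κ := ⟨hk1⟩
  have : IsMarkovKernel η := ⟨he1⟩
  have : Nonempty Y := ⟨y₀⟩
  have mmκ : ∀ x, ∫⁻ y, edist y y₀ ^ p ∂(κ x) ≠ ∞ := fun x => moment_ne_top hp y₀ _ (hk3 x y₀)
  have mmη : ∀ x, ∫⁻ y, edist y y₀ ^ p ∂(η x) ≠ ∞ := fun x => moment_ne_top hp y₀ _ (he3 x y₀)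
  obtain ⟨e, he⟩ := exists_surjective_nat (ℕ × ℕ × (ℕ × ℕ →₀ ℕ))
  choose θ hθ using fun n => exists_kernel κ η (fam_measurable (Y := Y) (e n))
  have θ1 : ∀ n x, (θ n x).map Prod.fst = κ x := fun n x => by
    rw [hθ]; exact cpl_fst (fam_measurable _) _ _
  have θ2 : ∀ n x, (θ n x).map Prod.snd = η x := fun n x => by
    rw [hθ]; exact cpl_snd (fam_measurable _) _ _
  set W : X → ℝ := fun x => Wcost (fun y z => dist y z ^ p) (κ x) (η x) with hW
  have W0 : ∀ x, 0 ≤ W x := fun x => wcost_nonneg p _ _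
  set J : ℕ → X → ℝ≥0∞ := fun n x => ∫⁻ w, edist w.1 w.2 ^ p ∂(θ n x) with hJ
  have mJ : ∀ n, Measurable (J n) := fun n => Measurable.lintegral_kernel (by fun_prop)
  have JW : ∀ x (δ : ℝ), 0 < δ → ∃ n, J n x ≤ ENNReal.ofReal (W x) + ENNReal.ofReal δ := by
    intro x δ hδ
    obtain ⟨i, hi⟩ := exists_fam_wcost hp y₀ (κ x) (η x) (mmκ x) (mmη x) hδ
    obtain ⟨n, rfl⟩ := he i
    refine ⟨n, ?_⟩
    simp only [hJ, hθ]
    exact hi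
  have WJ : ∀ n x, ENNReal.ofReal (W x) ≤ J n x := fun n x =>
    ENNReal.ofReal_le_of_le_toReal (wcost_le hp _ _ _ (θ1 n x) (θ2 n x))
  have Winf : ∀ x, ENNReal.ofReal (W x) = ⨅ n, J n x := by
    intro x
    refine le_antisymm (le_iInf fun n => WJ n x) ?_
    refine ENNReal.le_of_forall_pos_le_add fun δ hδ _ => ?_
    obtain ⟨n, hn⟩ := JW x δ (by exact_mod_cast hδ)
    rw [ENNReal.ofReal_coe_nnreal] at hn
    exact (iInf_le _ n).trans hn
  have mW' : Measurable fun x => ENNReal.ofReal (W x) := by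
    simp only [Winf]
    exact Measurable.iInf mJ
  have mW : Measurable W := by
    have := mW'.ennreal_toReal
    simpa only [ENNReal.toReal_ofReal (W0 _)] using this
  -- selection
  have hex := fun x => JW x ε hε
  set N : X → ℕ := fun x => Nat.find (hex x) with hN
  have mN : Measurable N :=
    measurable_find hex fun n => measurableSet_le (mJ n) (mW'.add measurable_const)
  let Θ : Kernel X (Y × Y) := ⟨fun x => θ (N x) x, by
    have : Measurable fun u : X × ℕ => θ u.2 u.1 :=
      measurable_from_prod_countable_left fun n => (θ n).measurable
    exact this.comp (measurable_id.prodMk mN)⟩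
  have Θ1 : ∀ x, (Θ x).map Prod.fst = κ x := fun x => θ1 (N x) x
  have Θ2 : ∀ x, (Θ x).map Prod.snd = η x := fun x => θ2 (N x) x
  have : IsMarkovKernel Θ := ⟨fun x => by
    constructor
    have : (Θ x).map Prod.fst Set.univ = 1 := by rw [Θ1]; simp
    rwa [Measure.map_apply measurable_fst MeasurableSet.univ] at this⟩
  have mφ : Measurable fun u : X × Y × Y => ((u.1, u.2.1), (u.1, u.2.2)) := by fun_prop
  set Γ : Measure ((X × Y) × (X × Y)) :=
    (lam ⊗ₘ Θ).map fun u : X × Y × Y => ((u.1, u.2.1), (u.1, u.2.2)) with hΓ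
  have Γ1 : Γ.map Prod.fst = lam ⊗ₘ κ := by
    refine Measure.ext_of_lintegral _ fun u hu => ?_
    rw [lintegral_map hu measurable_fst, hΓ, lintegral_map (by fun_prop) mφ,
      Measure.lintegral_compProd (by fun_prop), Measure.lintegral_compProd hu]
    refine lintegral_congr fun x => ?_
    rw [← Θ1 x, lintegral_map (by fun_prop) measurable_fst]
  have Γ2 : Γ.map Prod.snd = lam ⊗ₘ η := by
    refine Measure.ext_of_lintegral _ fun u hu => ?_
    rw [lintegral_map hu measurable_snd, hΓ, lintegral_map (by fun_prop) mφ,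
      Measure.lintegral_compProd (by fun_prop), Measure.lintegral_compProd hu]
    refine lintegral_congr fun x => ?_
    rw [← Θ2 x, lintegral_map (by fun_prop) measurable_snd]
  have L : ∫⁻ x, ENNReal.ofReal (W x) ∂lam ≠ ∞ := by
    refine ne_top_of_le_ne_top ?_ (lintegral_mono fun x =>
      (WJ 0 x).trans (coupling_cost_le hp y₀ _ _ _ (θ1 0 x) (θ2 0 x)))
    have m1 : Measurable fun x => ∫⁻ y, edist y y₀ ^ p ∂(κ x) :=
      Measurable.lintegral_kernel (by fun_prop)
    have m2 : Measurable fun x => ∫⁻ y, edist y y₀ ^ p ∂(η x) :=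
      Measurable.lintegral_kernel (by fun_prop)
    rw [lintegral_add_left (by fun_prop), lintegral_const_mul _ m1, lintegral_const_mul _ m2]
    exact ENNReal.add_ne_top.2 ⟨ENNReal.mul_ne_top (two_rpow_ne_top _) (mκ y₀),
      ENNReal.mul_ne_top (two_rpow_ne_top _) (mη y₀)⟩
  have cost : ∫ z, (dist z.1.1 z.2.1 ^ p + dist z.1.2 z.2.2 ^ p) ∂Γ ≤ (∫ x, W x ∂lam) + ε := by
    rw [integral_eq_lintegral_of_nonneg_ae (Eventually.of_forall W0) mW.aestronglyMeasurable,
      integral_eq_lintegral_of_nonneg_ae (Eventually.of_forall fun w => by positivity)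
        (by fun_prop)]
    have : (∫⁻ x, ENNReal.ofReal (W x) ∂lam).toReal + ε
        = (∫⁻ x, ENNReal.ofReal (W x) ∂lam + ENNReal.ofReal ε).toReal := by
      rw [ENNReal.toReal_add L ENNReal.ofReal_ne_top, ENNReal.toReal_ofReal hε.le]
    rw [this]
    refine ENNReal.toReal_mono (ENNReal.add_ne_top.2 ⟨L, ENNReal.ofReal_ne_top⟩) ?_
    rw [hΓ, lintegral_map (by fun_prop) mφ, Measure.lintegral_compProd (by fun_prop)]
    simp only [dist_self, Real.zero_rpow hp0.ne', zero_add, ofReal_dist_rpow hp]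
    calc ∫⁻ x, ∫⁻ w, edist w.1 w.2 ^ p ∂(Θ x) ∂lam
        ≤ ∫⁻ x, (ENNReal.ofReal (W x) + ENNReal.ofReal ε) ∂lam :=
          lintegral_mono fun x => Nat.find_spec (hex x)
      _ = _ := by rw [lintegral_add_left mW']; simp
  refine le_trans (csInf_le ⟨0, ?_⟩ ⟨Γ, Γ1, Γ2, rfl⟩) cost
  rintro r ⟨π, -, -, rfl⟩
  exact integral_nonneg fun w => by positivity

/-- The second inequality at the level of costs. -/
lemma second_ineq {p : ℝ} (hp : 1 ≤ p) (lam : Measure X) (hlam : MemPp p lam) (κ η : Kernel X Y)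
    (hκ : MemQp p κ) (hη : MemQp p η) :
    Wcost (fun y z => dist y z ^ p) (mix lam κ) (mix lam η) ≤
      Wcost (fun z w => dist z.1 w.1 ^ p + dist z.2 w.2 ^ p) (lam ⊗ₘ κ) (lam ⊗ₘ η) := by
  have hl := hlam.1
  have mκ := mix_moment hp lam hlam κ hκ
  have mη := mix_moment hp lam hlam η hη
  obtain ⟨hk1, -, hk3, x₀, y₀, -, -, -⟩ := hκ
  obtain ⟨he1, -, he3, -⟩ := hη
  have : IsMarkovKernel κ := ⟨hk1⟩
  have : IsMarkovKernel η := ⟨he1⟩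
  have mom : ∀ (ζ : Kernel X Y) [IsMarkovKernel ζ],
      ∫⁻ x, ∫⁻ y, edist y y₀ ^ p ∂(ζ x) ∂lam ≠ ∞ → ∫⁻ y, edist y y₀ ^ p ∂(mix lam ζ) ≠ ∞ := by
    intro ζ _ h
    rw [← mix_eq, lintegral_map (by fun_prop) measurable_snd,
      Measure.lintegral_compProd (by fun_prop)]
    exact h
  refine le_csInf ⟨_, (lam ⊗ₘ κ).prod (lam ⊗ₘ η), ?_, ?_, rfl⟩ ?_
  · simp [Measure.map_fst_prod]
  · simp [Measure.map_snd_prod]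
  rintro r ⟨Γ, Γ1, Γ2, rfl⟩
  have mX : Measurable fun z : (X × Y) × (X × Y) => (z.1.1, z.2.1) := by fun_prop
  have mY : Measurable fun z : (X × Y) × (X × Y) => (z.1.2, z.2.2) := by fun_prop
  have x1 : (Γ.map fun z => (z.1.1, z.2.1)).map Prod.fst = lam := by
    rw [Measure.map_map measurable_fst mX]
    calc _ = (Γ.map Prod.fst).map Prod.fst := (Measure.map_map measurable_fst measurable_fst).symm
      _ = lam := by rw [Γ1]; exact Measure.fst_compProd lam κ
  have x2 : (Γ.map fun z => (z.1.1, z.2.1)).map Prod.snd = lam := by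
    rw [Measure.map_map measurable_snd mX]
    calc _ = (Γ.map Prod.snd).map Prod.fst := (Measure.map_map measurable_fst measurable_snd).symm
      _ = lam := by rw [Γ2]; exact Measure.fst_compProd lam η
  have y1 : (Γ.map fun z => (z.1.2, z.2.2)).map Prod.fst = mix lam κ := by
    rw [Measure.map_map measurable_fst mY]
    calc _ = (Γ.map Prod.fst).map Prod.snd := (Measure.map_map measurable_snd measurable_fst).symm
      _ = _ := by rw [Γ1]; exact mix_eq lam κ
  have y2 : (Γ.map fun z => (z.1.2, z.2.2)).map Prod.snd = mix lam η := by
    rw [Measure.map_map measurable_snd mY]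
    calc _ = (Γ.map Prod.snd).map Prod.snd := (Measure.map_map measurable_snd measurable_snd).symm
      _ = _ := by rw [Γ2]; exact mix_eq lam η
  have ix := ((integrable_coupling hp x₀ lam lam _ x1 x2 (moment_ne_top hp x₀ _ (hlam.2 x₀))
    (moment_ne_top hp x₀ _ (hlam.2 x₀))).2).comp_measurable mX
  have iy := ((integrable_coupling hp y₀ _ _ _ y1 y2 (mom κ (mκ y₀)) (mom η (mη y₀))).2).comp_measurable mY
  calc Wcost (fun y z => dist y z ^ p) (mix lam κ) (mix lam η)
      ≤ ∫ w, dist w.1 w.2 ^ p ∂(Γ.map fun z => (z.1.2, z.2.2)) := by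
        rw [integral_dist hp]; exact wcost_le hp _ _ _ y1 y2
    _ = ∫ z, dist z.1.2 z.2.2 ^ p ∂Γ :=
        integral_map mY.aemeasurable (by fun_prop (disch := linarith))
    _ ≤ _ := by
        refine integral_mono iy (ix.add iy) fun z => ?_
        exact le_add_of_nonneg_left (by positivity)

end

end ITDProof

/-- For all `p ∈ [1, ∞)`, `λ ∈ 𝒫_p(𝒳)` and kernels `P, Q ∈ 𝒬_p(𝒳, 𝒴)`,
`𝒲_p^λ(P, Q) ≥ W_p(λ ⊛ P, λ ⊛ Q) ≥ W_p(λ ∘ P, λ ∘ Q)`. -/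
theorem itd_ge_wasserstein_semidirect_ge_wasserstein_mix {X Y : Type*}
    [MetricSpace X] [PolishSpace X] [MeasurableSpace X] [BorelSpace X]
    [MetricSpace Y] [PolishSpace Y] [MeasurableSpace Y] [BorelSpace Y]
    (p : ℝ) (hp : 1 ≤ p) (lam : Measure X) (hlam : MemPp p lam)
    (P Q : X → Measure Y) (hP : MemQp p P) (hQ : MemQp p Q) :
    WpProd p (semidirect lam P) (semidirect lam Q) ≤ ITD p lam P Q ∧
    Wp p (mix lam P) (mix lam Q) ≤ WpProd p (semidirect lam P) (semidirect lam Q) := by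
  have hl := hlam.1
  have hp0 : 0 < p := by linarith
  let κ : ProbabilityTheory.Kernel X Y := ⟨P, Measure.measurable_of_measurable_coe _ hP.2.1⟩
  let η : ProbabilityTheory.Kernel X Y := ⟨Q, Measure.measurable_of_measurable_coe _ hQ.2.1⟩
  have : ProbabilityTheory.IsMarkovKernel κ := ⟨hP.1⟩
  have : ProbabilityTheory.IsMarkovKernel η := ⟨hQ.1⟩
  have e1 := ITDProof.semidirect_eq lam κ
  have e2 := ITDProof.semidirect_eq lam η
  have f1 := fun (ε : ℝ) (hε : 0 < ε) => ITDProof.first_ineq hp lam hlam κ η hP hQ hε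
  have f2 := ITDProof.second_ineq hp lam hlam κ η hP hQ
  rw [← e1, ← e2] at f2
  simp only [← e1, ← e2] at f1
  constructor
  · unfold WpProd ITD Wp
    refine Real.rpow_le_rpow ?_ ?_ (by positivity)
    · refine Real.sInf_nonneg ?_
      rintro r ⟨π, -, -, rfl⟩
      exact integral_nonneg fun w => by positivity
    · have : ∀ x, (Wcost (fun x y => dist x y ^ p) (P x) (Q x) ^ (1 / p)) ^ p
          = Wcost (fun x y => dist x y ^ p) (P x) (Q x) := by
        intro x
        rw [← Real.rpow_mul (ITDProof.wcost_nonneg p _ _), one_div_mul_cancel hp0.ne',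
          Real.rpow_one]
      simp only [this]
      exact le_of_forall_pos_le_add f1
  · unfold WpProd Wp
    exact Real.rpow_le_rpow (ITDProof.wcost_nonneg p _ _) f2 (by positivity)
end

section
/- Let P, Q ∈ 𝒬_p(𝒳,𝒴) be Lipschitz continuous kernels with Lipschitz constants L_P and L_Q, and suppose W_p(P(·|x), Q(·|x)) ≤ R for all x ∈ 𝒳 for a constant R. Then the function f(x) = [W_p(P(·|x), Q(·|x))]^p is Lipschitz continuous on 𝒳 with constant p·R^{p−1}·(L_P + L_Q), i.e., |f(x) − f(x')| ≤ p·R^{p−1}·(L_P + L_Q)·d(x,x') for all x, x' ∈ 𝒳. -/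
open MeasureTheory Filter

/-- A kernel `Q` is Lipschitz continuous with constant `L` if
`W_p(Q(·|x), Q(·|x')) ≤ L · d(x, x')` for all `x, x'`. -/
def KernelLip {X Y : Type*} [MeasurableSpace X] [PseudoMetricSpace X]
    [MeasurableSpace Y] [PseudoMetricSpace Y] (p L : ℝ) (Q : X → Measure Y) : Prop :=
  ∀ x x' : X, Wp p (Q x) (Q x') ≤ L * dist x x'

open ProbabilityTheory

lemma rpow_sub_le_aux {p a b : ℝ} (hp : 1 ≤ p) (hb : 0 ≤ b) (hab : b ≤ a) :
    a ^ p - b ^ p ≤ p * a ^ (p - 1) * (a - b) := by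
  rcases (hb.trans hab).eq_or_lt with h | h
  · have : b = a := by linarith
    subst this; simp
  · have h1 := one_add_mul_self_le_rpow_one_add (s := b / a - 1)
      (by have := div_nonneg hb h.le; linarith) hp
    have h2 : (1 + (b / a - 1)) ^ p = b ^ p / a ^ p := by
      rw [← Real.div_rpow hb h.le]; congr 1; ring
    have hap : 0 < a ^ p := Real.rpow_pos_of_pos h p
    rw [h2, le_div_iff₀ hap] at h1
    have h3 : a ^ p = a ^ (p - 1) * a := by
      rw [Real.rpow_sub_one h.ne']; field_simp
    have h4 : (1 + p * (b / a - 1)) * a ^ p = a ^ p - p * a ^ (p - 1) * (a - b) := by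
      rw [h3]; field_simp; ring
    linarith

section aux
variable {Y : Type*} [MetricSpace Y] [PolishSpace Y] [MeasurableSpace Y] [BorelSpace Y]

/-- The `L^p` cost of a coupling. -/
noncomputable def cpl (p : ℝ) (π : Measure (Y × Y)) : ℝ :=
  (eLpNorm (fun z : Y × Y => dist z.1 z.2) (ENNReal.ofReal p) π).toReal

lemma memLp_of_coupling {p : ℝ} (hp : 1 ≤ p) {μ ν : Measure Y} (hμ : MemPp p μ)
    (hν : MemPp p ν) {π : Measure (Y × Y)} (h1 : π.map Prod.fst = μ) (h2 : π.map Prod.snd = ν) :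
    MemLp (fun z : Y × Y => dist z.1 z.2) (ENNReal.ofReal p) π := by
  have hp0 : 0 < p := by linarith
  rcases isEmpty_or_nonempty Y with hY | ⟨⟨y₀⟩⟩
  · rw [Measure.eq_zero_of_isEmpty π]; simp
  have key : ∀ ρ : Measure Y, MemPp p ρ → MemLp (fun y => dist y₀ y) (ENNReal.ofReal p) ρ := by
    intro ρ hρ
    rw [← integrable_norm_rpow_iff (by fun_prop) (by simpa using hp0) (by simp)]
    simpa [ENNReal.toReal_ofReal hp0.le, abs_of_nonneg dist_nonneg] using hρ.2 y₀
  have a1 : MemLp (fun z : Y × Y => dist y₀ z.1) (ENNReal.ofReal p) π :=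
    (key μ hμ).comp_measurePreserving ⟨measurable_fst, h1⟩
  have a2 : MemLp (fun z : Y × Y => dist y₀ z.2) (ENNReal.ofReal p) π :=
    (key ν hν).comp_measurePreserving ⟨measurable_snd, h2⟩
  refine (a1.add a2).mono (by fun_prop) (ae_of_all _ fun z => ?_)
  simp only [Pi.add_apply, Real.norm_eq_abs]
  rw [abs_of_nonneg dist_nonneg, abs_of_nonneg (by positivity)]
  exact dist_triangle_left _ _ _

lemma cpl_eq {p : ℝ} (hp : 1 ≤ p) {μ ν : Measure Y} (hμ : MemPp p μ)
    (hν : MemPp p ν) {π : Measure (Y × Y)} (h1 : π.map Prod.fst = μ) (h2 : π.map Prod.snd = ν) :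
    cpl p π = (∫ z, dist z.1 z.2 ^ p ∂π) ^ (1 / p) := by
  have hp0 : 0 < p := by linarith
  have h := (memLp_of_coupling hp hμ hν h1 h2).eLpNorm_eq_integral_rpow_norm
    (by simpa using hp0) (by simp)
  rw [cpl, h, ENNReal.toReal_ofReal (by positivity), ENNReal.toReal_ofReal hp0.le]
  simp [abs_of_nonneg dist_nonneg]

lemma cost_nonneg {p : ℝ} {μ ν : Measure Y} :
    0 ≤ Wcost (fun x y : Y => dist x y ^ p) μ ν := by
  apply Real.sInf_nonneg
  rintro r ⟨π, -, -, rfl⟩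
  exact integral_nonneg fun z => by positivity

lemma Wp_nonneg {p : ℝ} {μ ν : Measure Y} : 0 ≤ Wp p μ ν :=
  Real.rpow_nonneg cost_nonneg _

lemma Wp_le_cpl {p : ℝ} (hp : 1 ≤ p) {μ ν : Measure Y} (hμ : MemPp p μ)
    (hν : MemPp p ν) {π : Measure (Y × Y)} (h1 : π.map Prod.fst = μ) (h2 : π.map Prod.snd = ν) :
    Wp p μ ν ≤ cpl p π := by
  rw [cpl_eq hp hμ hν h1 h2]
  refine Real.rpow_le_rpow cost_nonneg ?_ (by positivity)
  refine csInf_le ⟨0, ?_⟩ ⟨π, h1, h2, rfl⟩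
  rintro r ⟨π, -, -, rfl⟩
  exact integral_nonneg fun z => by positivity

lemma exists_cpl {p : ℝ} (hp : 1 ≤ p) {μ ν : Measure Y} (hμ : MemPp p μ)
    (hν : MemPp p ν) {ε : ℝ} (hε : 0 < ε) : ∃ π : Measure (Y × Y),
      π.map Prod.fst = μ ∧ π.map Prod.snd = ν ∧ cpl p π < Wp p μ ν + ε := by
  have hp0 : 0 < p := by linarith
  have := hμ.1
  have := hν.1
  have hlt : Wcost (fun x y : Y => dist x y ^ p) μ ν < (Wp p μ ν + ε) ^ p := by
    have h : Wp p μ ν ^ p = Wcost (fun x y : Y => dist x y ^ p) μ ν := by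
      rw [Wp, ← Real.rpow_mul cost_nonneg, one_div_mul_cancel hp0.ne', Real.rpow_one]
    rw [← h]
    exact Real.rpow_lt_rpow Wp_nonneg (by linarith) hp0
  obtain ⟨r, ⟨π, h1, h2, rfl⟩, hr⟩ := exists_lt_of_csInf_lt
    (by exact ⟨_, μ.prod ν, by simp [← Measure.fst.eq_1], by simp [← Measure.snd.eq_1], rfl⟩) hlt
  refine ⟨π, h1, h2, ?_⟩
  rw [cpl_eq hp hμ hν h1 h2]
  have h0 : 0 ≤ ∫ z : Y × Y, dist z.1 z.2 ^ p ∂π := integral_nonneg fun z => by positivity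
  calc _ < ((Wp p μ ν + ε) ^ p) ^ (1 / p) := Real.rpow_lt_rpow h0 hr (by positivity)
    _ = _ := by
      rw [← Real.rpow_mul (by have := Wp_nonneg (p := p) (μ := μ) (ν := ν); positivity),
        mul_one_div_cancel hp0.ne', Real.rpow_one]

lemma map_swap_coupling {π : Measure (Y × Y)} {μ ν : Measure Y} (h1 : π.map Prod.fst = μ)
    (h2 : π.map Prod.snd = ν) :
    (π.map Prod.swap).map Prod.fst = ν ∧ (π.map Prod.swap).map Prod.snd = μ := by
  rw [Measure.map_map measurable_fst measurable_swap,
    Measure.map_map measurable_snd measurable_swap]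
  exact ⟨h2, h1⟩

lemma cpl_swap {p : ℝ} {π : Measure (Y × Y)} : cpl p (π.map Prod.swap) = cpl p π := by
  rw [cpl, eLpNorm_map_measure (by fun_prop) (by fun_prop), cpl]
  congr 2
  ext z
  simp [dist_comm]

lemma Wp_symm_le {p : ℝ} (hp : 1 ≤ p) {μ ν : Measure Y} (hμ : MemPp p μ) (hν : MemPp p ν) :
    Wp p μ ν ≤ Wp p ν μ := by
  refine le_of_forall_pos_le_add fun ε hε => ?_
  obtain ⟨π, h1, h2, h⟩ := exists_cpl hp hν hμ hε
  obtain ⟨h3, h4⟩ := map_swap_coupling h1 h2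
  have := Wp_le_cpl hp hμ hν h3 h4
  rw [cpl_swap] at this
  linarith

lemma exists_glue {π₁ π₂ : Measure (Y × Y)} {ν : Measure Y} [IsProbabilityMeasure ν]
    (h1 : π₁.map Prod.fst = ν) (h2 : π₂.map Prod.fst = ν) :
    ∃ γ : Measure (Y × (Y × Y)), γ.map (fun w => (w.1, w.2.1)) = π₁ ∧
      γ.map (fun w => (w.1, w.2.2)) = π₂ := by
  have : Nonempty Y := ν.nonempty_of_neZero
  have i1 : IsProbabilityMeasure π₁ := ⟨by
    rw [← measure_univ (μ := ν), ← h1, Measure.map_apply measurable_fst .univ, Set.preimage_univ]⟩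
  have i2 : IsProbabilityMeasure π₂ := ⟨by
    rw [← measure_univ (μ := ν), ← h2, Measure.map_apply measurable_fst .univ, Set.preimage_univ]⟩
  have d1 : ν ⊗ₘ π₁.condKernel = π₁ := by
    have := π₁.disintegrate π₁.condKernel
    rwa [Measure.fst, h1] at this
  have d2 : ν ⊗ₘ π₂.condKernel = π₂ := by
    have := π₂.disintegrate π₂.condKernel
    rwa [Measure.fst, h2] at this
  refine ⟨ν ⊗ₘ (π₁.condKernel ×ₖ π₂.condKernel), ?_, ?_⟩
  · have h := Measure.compProd_map (μ := ν) (κ := π₁.condKernel ×ₖ π₂.condKernel)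
      (f := Prod.fst) measurable_fst
    rw [← Kernel.fst_eq, Kernel.fst_prod, d1] at h
    exact h.symm
  · have h := Measure.compProd_map (μ := ν) (κ := π₁.condKernel ×ₖ π₂.condKernel)
      (f := Prod.snd) measurable_snd
    rw [← Kernel.snd_eq, Kernel.snd_prod, d2] at h
    exact h.symm

lemma Wp_triangle {p : ℝ} (hp : 1 ≤ p) {μ ν ρ : Measure Y} (hμ : MemPp p μ) (hν : MemPp p ν)
    (hρ : MemPp p ρ) : Wp p μ ρ ≤ Wp p μ ν + Wp p ν ρ := by
  refine le_of_forall_pos_le_add fun ε hε => ?_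
  obtain ⟨π₁, a1, a2, ha⟩ := exists_cpl hp hμ hν (half_pos hε)
  obtain ⟨π₂, b1, b2, hb⟩ := exists_cpl hp hν hρ (half_pos hε)
  obtain ⟨a3, a4⟩ := map_swap_coupling a1 a2
  have := hν.1
  obtain ⟨γ, g1, g2⟩ := exists_glue a3 b1
  rw [← cpl_swap] at ha
  have m1 := memLp_of_coupling hp hν hμ a3 a4
  have m2 := memLp_of_coupling hp hν hρ b1 b2
  set π₁' := π₁.map Prod.swap
  have c1 : (γ.map (fun w => (w.2.1, w.2.2))).map Prod.fst = μ := by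
    rw [← a4, ← g1, Measure.map_map (by fun_prop) (by fun_prop),
      Measure.map_map (by fun_prop) (by fun_prop)]
    rfl
  have c2 : (γ.map (fun w => (w.2.1, w.2.2))).map Prod.snd = ρ := by
    rw [← b2, ← g2, Measure.map_map (by fun_prop) (by fun_prop),
      Measure.map_map (by fun_prop) (by fun_prop)]
    rfl
  have hW := Wp_le_cpl hp hμ hρ c1 c2
  have e1 : eLpNorm (fun z : Y × Y => dist z.1 z.2) (ENNReal.ofReal p) π₁' =
      eLpNorm (fun w : Y × (Y × Y) => dist w.1 w.2.1) (ENNReal.ofReal p) γ := by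
    rw [← g1, eLpNorm_map_measure (by fun_prop) (by fun_prop)]
    rfl
  have e2 : eLpNorm (fun z : Y × Y => dist z.1 z.2) (ENNReal.ofReal p) π₂ =
      eLpNorm (fun w : Y × (Y × Y) => dist w.1 w.2.2) (ENNReal.ofReal p) γ := by
    rw [← g2, eLpNorm_map_measure (by fun_prop) (by fun_prop)]
    rfl
  have hc : cpl p (γ.map (fun w => (w.2.1, w.2.2))) ≤ cpl p π₁' + cpl p π₂ := by
    unfold cpl
    rw [← ENNReal.toReal_add m1.eLpNorm_ne_top m2.eLpNorm_ne_top]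
    refine ENNReal.toReal_mono (ENNReal.add_ne_top.2 ⟨m1.eLpNorm_ne_top, m2.eLpNorm_ne_top⟩) ?_
    rw [e1, e2, eLpNorm_map_measure (by fun_prop) (by fun_prop)]
    refine le_trans (eLpNorm_mono_real fun w => ?_)
      (eLpNorm_add_le (by fun_prop) (by fun_prop) (by simpa using hp))
    simp only [Pi.add_apply, Function.comp, Real.norm_eq_abs]
    rw [abs_of_nonneg dist_nonneg]
    exact dist_triangle_left _ _ _
  linarith

end aux

/-- If `P, Q ∈ 𝒬_p(𝒳, 𝒴)` are Lipschitz kernels with constants `L_P`, `L_Q`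
and `W_p(P(·|x), Q(·|x)) ≤ R` for all `x`, then `f(x) = W_p(P(·|x), Q(·|x))^p` is Lipschitz
with constant `p · R^{p−1} · (L_P + L_Q)`. -/
theorem wasserstein_pow_between_lipschitz_kernels_lipschitz {X Y : Type*}
    [MetricSpace X] [PolishSpace X] [MeasurableSpace X] [BorelSpace X]
    [MetricSpace Y] [PolishSpace Y] [MeasurableSpace Y] [BorelSpace Y]
    (p : ℝ) (hp : 1 ≤ p) (P Q : X → Measure Y) (hP : MemQp p P) (hQ : MemQp p Q)
    (LP LQ : ℝ) (hPLip : KernelLip p LP P) (hQLip : KernelLip p LQ Q)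
    (R : ℝ) (hR : ∀ x : X, Wp p (P x) (Q x) ≤ R) :
    ∀ x x' : X, |Wp p (P x) (Q x) ^ p - Wp p (P x') (Q x') ^ p| ≤
      p * R ^ (p - 1) * (LP + LQ) * dist x x' := by


  intro x x'
  have mP : ∀ x, MemPp p (P x) := fun x => ⟨hP.1 x, hP.2.2.1 x⟩
  have mQ : ∀ x, MemPp p (Q x) := fun x => ⟨hQ.1 x, hQ.2.2.1 x⟩
  have key : ∀ x x' : X, Wp p (P x') (Q x') ≤ Wp p (P x) (Q x) →
      |Wp p (P x) (Q x) ^ p - Wp p (P x') (Q x') ^ p| ≤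
      p * R ^ (p - 1) * (LP + LQ) * dist x x' := by
    intro x x' hle
    have t1 := Wp_triangle hp (mP x) (mP x') (mQ x)
    have t2 := Wp_triangle hp (mP x') (mQ x') (mQ x)
    have t3 := Wp_symm_le hp (mQ x') (mQ x)
    have l1 := hPLip x x'
    have l2 := hQLip x x'
    have n0 : 0 ≤ Wp p (P x') (Q x') := Wp_nonneg
    have hd : Wp p (P x) (Q x) - Wp p (P x') (Q x') ≤ (LP + LQ) * dist x x' := by linarith
    rw [abs_of_nonneg (sub_nonneg.2 (Real.rpow_le_rpow n0 hle (by linarith)))]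
    refine (rpow_sub_le_aux hp n0 hle).trans ?_
    rw [mul_assoc (p * R ^ (p - 1))]
    have hpow : Wp p (P x) (Q x) ^ (p - 1) ≤ R ^ (p - 1) :=
      Real.rpow_le_rpow Wp_nonneg (hR x) (by linarith)
    have hRn : 0 ≤ R ^ (p - 1) := (Real.rpow_nonneg Wp_nonneg _).trans hpow
    refine mul_le_mul (mul_le_mul_of_nonneg_left hpow (by linarith)) hd (by linarith) ?_
    exact mul_nonneg (by linarith) hRn
  rcases le_total (Wp p (P x') (Q x')) (Wp p (P x) (Q x)) with h | h
  · exact key x x' h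
  · rw [abs_sub_comm, dist_comm]
    exact key x' x h
end

section
/- Let μ, ν ∈ 𝒫_1(𝒳) on a Polish metric space (𝒳, d). Then the order-1 Wasserstein distance admits the dual representation W_1(μ,ν) = sup{ ∫ ψ dμ − ∫ ψ dν : ψ : 𝒳 → ℝ is 1-Lipschitz }. -/
open MeasureTheory

/-- The order-1 Wasserstein (optimal transport) distance between `μ` and `ν`:
the infimum of `∫ d(x, y) dπ` over all couplings `π` of `μ` and `ν`. -/
noncomputable def W1 {α : Type*} [MeasurableSpace α] [PseudoMetricSpace α]
    (μ ν : Measure α) : ℝ :=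
  sInf {r : ℝ | ∃ π : Measure (α × α),
    π.map Prod.fst = μ ∧ π.map Prod.snd = ν ∧ r = ∫ z, dist z.1 z.2 ∂π}

/-- `μ ∈ 𝒫_1(α)`: probability measure with finite first moment. -/
def MemP1 {α : Type*} [MeasurableSpace α] [PseudoMetricSpace α] (μ : Measure α) : Prop :=
  IsProbabilityMeasure μ ∧ ∀ x₀ : α, Integrable (fun x => dist x₀ x) μ

theorem kr_finite {ι : Type} [Fintype ι] [DecidableEq ι] (d : ι → ι → ℝ) (a b : ι → ℝ)
    (ha : ∀ i, 0 ≤ a i) (hb : ∀ i, 0 ≤ b i) (ha1 : ∑ i, a i = 1) (hb1 : ∑ i, b i = 1) (c : ℝ)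
    (h : ∀ p : ι → ι → ℝ, (∀ i j, 0 ≤ p i j) → (∀ i, ∑ j, p i j = a i) →
      (∀ j, ∑ i, p i j = b j) → c < ∑ i, ∑ j, p i j * d i j) :
    ∃ φ χ : ι → ℝ, (∀ i j, φ i + χ j ≤ d i j) ∧ c < ∑ i, φ i * a i + ∑ j, χ j * b j := by
  let L : (ι × ι → ℝ) →ₗ[ℝ] ((ι → ℝ) × (ι → ℝ) × ℝ) :=
    { toFun := fun p => (fun i => ∑ j, p (i, j), fun j => ∑ i, p (i, j),
        ∑ i, ∑ j, p (i, j) * d i j)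
      map_add' := by
        intro p q
        ext <;> simp [Finset.sum_add_distrib, add_mul]
      map_smul' := by
        intro r p
        ext <;> simp [Finset.mul_sum, mul_assoc] }
  have hLc : Continuous L := L.continuous_of_finiteDimensional
  let B : Set ((ι → ℝ) × (ι → ℝ) × ℝ) := L '' stdSimplex ℝ (ι × ι)
  let C : Set ((ι → ℝ) × (ι → ℝ) × ℝ) := {a} ×ˢ ({b} ×ˢ Set.Iic c)
  have hBc : Convex ℝ B := (convex_stdSimplex ℝ _).linear_image L
  have hBk : IsCompact B := (isCompact_stdSimplex ℝ (ι × ι)).image hLc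
  have hCc : Convex ℝ C := (convex_singleton a).prod ((convex_singleton b).prod (convex_Iic c))
  have hCk : IsClosed C := isClosed_singleton.prod (isClosed_singleton.prod isClosed_Iic)
  have hdisj : Disjoint B C := by
    rw [Set.disjoint_left]
    rintro _ ⟨p, hp, rfl⟩ ⟨h1, h2, h3⟩
    have := h (fun i j => p (i, j)) (fun i j => hp.1 _) (fun i => congrFun h1 i)
      (fun j => congrFun h2 j)
    exact absurd h3 (not_le.mpr this)
  obtain ⟨f, u, v, hfB, huv, hfC⟩ := geometric_hahn_banach_compact_closed hBc hBk hCc hCk hdisj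
  let φ : ι → ℝ := fun i => f (Pi.single i 1, 0, 0)
  let χ : ι → ℝ := fun i => f (0, Pi.single i 1, 0)
  let l : ℝ := f (0, 0, 1)
  have hf : ∀ x y t, f (x, y, t) = ∑ i, φ i * x i + ∑ i, χ i * y i + l * t := by
    intro x y t
    have e1 : f (x, 0, 0) = ∑ i, φ i * x i := by
      have : (x, (0 : ι → ℝ), (0 : ℝ)) = ∑ i, x i • ((Pi.single i 1 : ι → ℝ), (0 : ι → ℝ), (0:ℝ)) := by
        ext j <;> simp [Prod.fst_sum, Prod.snd_sum, Finset.sum_apply, Pi.single_apply]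
      rw [this, map_sum]
      simp only [map_smul, smul_eq_mul]
      exact Finset.sum_congr rfl fun i _ => mul_comm _ _
    have e2 : f (0, y, 0) = ∑ i, χ i * y i := by
      have : ((0 : ι → ℝ), y, (0 : ℝ)) = ∑ i, y i • ((0 : ι → ℝ), (Pi.single i 1 : ι → ℝ), (0:ℝ)) := by
        ext j <;> simp [Prod.fst_sum, Prod.snd_sum, Finset.sum_apply, Pi.single_apply]
      rw [this, map_sum]
      simp only [map_smul, smul_eq_mul]
      exact Finset.sum_congr rfl fun i _ => mul_comm _ _
    have e3 : f (0, 0, t) = l * t := by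
      have : ((0 : ι → ℝ), (0 : ι → ℝ), t) = t • ((0 : ι → ℝ), (0 : ι → ℝ), (1:ℝ)) := by
        ext <;> simp
      rw [this, map_smul, smul_eq_mul, mul_comm]
    rw [← e1, ← e2, ← e3, ← map_add, ← map_add]
    simp
  set D := ∑ i, φ i * a i + ∑ i, χ i * b i with hD
  have hC' : ∀ s ≤ c, v < D + l * s := fun s hs => by
    have := hfC (a, b, s) ⟨rfl, rfl, hs⟩
    rwa [hf] at this
  have hBp : ∀ p ∈ stdSimplex ℝ (ι × ι), ∑ i, φ i * (∑ j, p (i, j)) + ∑ j, χ j * (∑ i, p (i, j))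
      + l * (∑ i, ∑ j, p (i, j) * d i j) < u := fun p hp => by
    have := hfB (L p) ⟨p, hp, rfl⟩
    rwa [show L p = (fun i => ∑ j, p (i, j), fun j => ∑ i, p (i, j),
        ∑ i, ∑ j, p (i, j) * d i j) from rfl, hf] at this
  -- the product coupling
  have hprod := hBp (fun z => a z.1 * b z.2) ⟨fun z => mul_nonneg (ha _) (hb _), by
    rw [Fintype.sum_prod_type]; simp [← Finset.mul_sum, hb1, ha1]⟩
  have hprodc := h (fun i j => a i * b j) (fun i j => mul_nonneg (ha _) (hb _))
    (fun i => by simp [← Finset.mul_sum, hb1]) (fun i => by simp [← Finset.sum_mul, ha1])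
  simp only [← Finset.mul_sum, hb1, ← Finset.sum_mul, ha1, mul_one, one_mul] at hprod
  rw [← hD] at hprod
  have hl : l < 0 := by
    have := hC' c le_rfl
    by_contra hl
    push Not at hl
    nlinarith
  have hdel : ∀ i j, φ i + χ j + l * d i j < u := by
    intro i j
    have := hBp (Pi.single (i, j) 1) (single_mem_stdSimplex ℝ (i, j))
    have e : ∀ i' j', (Pi.single (i, j) (1:ℝ) : ι × ι → ℝ) (i', j') =
        if i' = i then (if j' = j then 1 else 0) else 0 := by
      intro i' j'
      simp only [Pi.single_apply, Prod.mk.injEq]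
      split_ifs <;> simp_all
    simpa [e, Finset.sum_ite_irrel] using this
  refine ⟨fun i => (φ i - u) / (-l), fun j => χ j / (-l), ?_, ?_⟩
  · intro i j
    have := hdel i j
    rw [← add_div, div_le_iff₀ (by linarith)]
    nlinarith
  · have := hC' c le_rfl
    have e : ∑ i, (φ i - u) / (-l) * a i + ∑ j, χ j / (-l) * b j = (D - u) / (-l) := by
      have e1 : ∑ i, (φ i - u) / (-l) * a i = (∑ i, φ i * a i - u) / (-l) := by
        have e0 : u = ∑ i, u * a i := by rw [← Finset.mul_sum, ha1, mul_one]
        calc ∑ i, (φ i - u) / (-l) * a i = (∑ i, φ i * a i - ∑ i, u * a i) / (-l) := by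
              rw [← Finset.sum_sub_distrib, Finset.sum_div]
              exact Finset.sum_congr rfl fun i _ => by ring
          _ = _ := by rw [← e0]
      have e2 : ∑ j, χ j / (-l) * b j = (∑ j, χ j * b j) / (-l) := by
        rw [Finset.sum_div]
        exact Finset.sum_congr rfl fun i _ => by ring
      rw [e1, e2, hD]; ring
    rw [e, lt_div_iff₀ (by linarith)]
    nlinarith

theorem kr_discretize {X : Type*}
    [MetricSpace X] [PolishSpace X] [MeasurableSpace X] [BorelSpace X]
    (μ ν : Measure X) (hμ : MemP1 μ) (hν : MemP1 ν) (ε : ℝ) (hε : 0 < ε) :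
    ∃ (n : ℕ) (e : Fin n → X) (T : X → Fin n), Measurable T ∧
      ∫ x, dist x (e (T x)) ∂μ ≤ ε ∧ ∫ x, dist x (e (T x)) ∂ν ≤ ε := by
  have := hμ.1
  have : Nonempty X := μ.nonempty_of_neZero
  let e : ℕ → X := TopologicalSpace.denseSeq X
  have key : ∀ ρ : Measure X, MemP1 ρ →
      Filter.Tendsto (fun N => ∫ x, dist x (SimpleFunc.nearestPt e N x) ∂ρ) Filter.atTop
        (nhds 0) := by
    intro ρ hρ
    have := tendsto_integral_of_dominated_convergence (μ := ρ)
      (F := fun N x => dist x (SimpleFunc.nearestPt e N x)) (f := fun _ => (0:ℝ))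
      (fun x => dist (e 0) x)
      (fun N => (measurable_id.dist (SimpleFunc.nearestPt e N).measurable).aestronglyMeasurable)
      (hρ.2 _)
      (fun N => Filter.Eventually.of_forall fun x => by
        have := SimpleFunc.edist_nearestPt_le e x (Nat.zero_le N)
        rw [edist_dist, edist_dist, ENNReal.ofReal_le_ofReal_iff dist_nonneg] at this
        rwa [Real.norm_of_nonneg dist_nonneg, dist_comm])
      (Filter.Eventually.of_forall fun x => by
        have h := SimpleFunc.tendsto_nearestPt (e := e) (x := x)
          (TopologicalSpace.denseRange_denseSeq X x)
        have := (tendsto_const_nhds (x := x)).dist h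
        simpa using this)
    simpa using this
  obtain ⟨N, h1, h2⟩ := (((key μ hμ).eventually (eventually_le_nhds hε)).and
    ((key ν hν).eventually (eventually_le_nhds hε))).exists
  refine ⟨N + 1, fun i => e i, fun x => ⟨SimpleFunc.nearestPtInd e N x,
    Nat.lt_succ_of_le (SimpleFunc.nearestPtInd_le e N x)⟩, ?_, h1, h2⟩
  refine measurable_to_countable' fun i => ?_
  have : (fun x => (⟨SimpleFunc.nearestPtInd e N x,
    Nat.lt_succ_of_le (SimpleFunc.nearestPtInd_le e N x)⟩ : Fin (N+1))) ⁻¹' {i}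
      = (SimpleFunc.nearestPtInd e N) ⁻¹' {(i : ℕ)} := by
    ext x; simp [Fin.ext_iff]
  rw [this]
  exact SimpleFunc.measurableSet_fiber _ _

theorem kr_glue_marg {X : Type*} [MeasurableSpace X] (μ : Measure X) [IsProbabilityMeasure μ]
    {n : ℕ} (T : X → Fin n) (hT : Measurable T) (w : Fin n → ENNReal)
    (hw : ∀ i, μ (T ⁻¹' {i}) ≠ 0 → w i = 1) :
    ∑ i, w i • μ.restrict (T ⁻¹' {i}) = μ := by
  have h1 : ∀ i, w i • μ.restrict (T ⁻¹' {i}) = μ.restrict (T ⁻¹' {i}) := by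
    intro i
    by_cases h : μ (T ⁻¹' {i}) = 0
    · rw [Measure.restrict_eq_zero.mpr h, smul_zero]
    · rw [hw i h, one_smul]
  simp_rw [h1]
  rw [← Measure.sum_fintype, ← Measure.restrict_iUnion]
  · rw [← Set.preimage_iUnion, Set.iUnion_of_singleton, Set.preimage_univ, Measure.restrict_univ]
  · intro i j hij
    exact (Set.disjoint_singleton.mpr hij).preimage T
  · exact fun i => hT (measurableSet_singleton i)

theorem kr_glue {X : Type*} [MeasurableSpace X] (μ ν : Measure X) [IsProbabilityMeasure μ]
    [IsProbabilityMeasure ν]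
    {n : ℕ} (T : X → Fin n) (hT : Measurable T) (p : Fin n → Fin n → ℝ) (hp : ∀ i j, 0 ≤ p i j)
    (h1 : ∀ i, ∑ j, p i j = μ.real (T ⁻¹' {i})) (h2 : ∀ j, ∑ i, p i j = ν.real (T ⁻¹' {j})) :
    ∃ π : Measure (X × X), π.map Prod.fst = μ ∧ π.map Prod.snd = ν ∧
      ∀ d : Fin n → Fin n → ℝ, ∫ z, d (T z.1) (T z.2) ∂π = ∑ i, ∑ j, p i j * d i j := by
  have hA : ∀ i, MeasurableSet (T ⁻¹' {i}) := fun i => hT (measurableSet_singleton i)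
  have p1 : ∀ i j, μ.real (T ⁻¹' {i}) = 0 → p i j = 0 := by
    intro i j h
    rw [← h1] at h
    exact (Finset.sum_eq_zero_iff_of_nonneg (fun j _ => hp i j)).mp h j (Finset.mem_univ _)
  have p2 : ∀ i j, ν.real (T ⁻¹' {j}) = 0 → p i j = 0 := by
    intro i j h
    rw [← h2] at h
    exact (Finset.sum_eq_zero_iff_of_nonneg (fun i _ => hp i j)).mp h i (Finset.mem_univ _)
  let g : Fin n → Fin n → ENNReal := fun i j =>
    ENNReal.ofReal (p i j / (μ.real (T ⁻¹' {i}) * ν.real (T ⁻¹' {j})))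
  refine ⟨∑ i, ∑ j, g i j • (μ.restrict (T ⁻¹' {i})).prod (ν.restrict (T ⁻¹' {j})), ?_, ?_, ?_⟩
  · have : ∀ m : Fin n → Fin n → Measure (X × X), (∑ i, ∑ j, m i j).map Prod.fst
        = ∑ i, ∑ j, (m i j).map Prod.fst := by
      intro m
      simp only [← Measure.mapₗ_apply_of_measurable measurable_fst, map_sum]
    rw [this]
    simp only [Measure.map_smul, Measure.map_fst_prod, smul_smul, ← Finset.sum_smul]
    refine kr_glue_marg μ T hT _ fun i hi => ?_
    have hi' : μ.real (T ⁻¹' {i}) ≠ 0 := by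
      simpa [Measure.real, ENNReal.toReal_eq_zero_iff] using hi
    have : ∀ j, g i j * (ν.restrict (T ⁻¹' {j})) Set.univ
        = ENNReal.ofReal (p i j / μ.real (T ⁻¹' {i})) := by
      intro j
      rw [Measure.restrict_apply_univ, ← ofReal_measureReal, ← ENNReal.ofReal_mul
        (div_nonneg (hp _ _) (mul_nonneg measureReal_nonneg measureReal_nonneg))]
      congr 1
      by_cases hj : ν.real (T ⁻¹' {j}) = 0
      · simp [hj, p2 i j hj]
      · field_simp
    simp_rw [this]
    rw [← ENNReal.ofReal_sum_of_nonneg fun j _ => div_nonneg (hp _ _) measureReal_nonneg,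
      ← Finset.sum_div, h1, div_self hi', ENNReal.ofReal_one]
  · have : ∀ m : Fin n → Fin n → Measure (X × X), (∑ i, ∑ j, m i j).map Prod.snd
        = ∑ j, ∑ i, (m i j).map Prod.snd := by
      intro m
      rw [Finset.sum_comm]
      simp only [← Measure.mapₗ_apply_of_measurable measurable_snd, map_sum]
    rw [this]
    simp only [Measure.map_smul, Measure.map_snd_prod, smul_smul, ← Finset.sum_smul]
    refine kr_glue_marg ν T hT _ fun j hj => ?_
    have hj' : ν.real (T ⁻¹' {j}) ≠ 0 := by
      simpa [Measure.real, ENNReal.toReal_eq_zero_iff] using hj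
    have : ∀ i, g i j * (μ.restrict (T ⁻¹' {i})) Set.univ
        = ENNReal.ofReal (p i j / ν.real (T ⁻¹' {j})) := by
      intro i
      rw [Measure.restrict_apply_univ, ← ofReal_measureReal, ← ENNReal.ofReal_mul
        (div_nonneg (hp _ _) (mul_nonneg measureReal_nonneg measureReal_nonneg))]
      congr 1
      by_cases hi : μ.real (T ⁻¹' {i}) = 0
      · simp [hi, p1 i j hi]
      · field_simp
    simp_rw [this]
    rw [← ENNReal.ofReal_sum_of_nonneg fun j _ => div_nonneg (hp _ _) measureReal_nonneg,
      ← Finset.sum_div, h2, div_self hj', ENNReal.ofReal_one]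
  · intro d
    have hm : Measurable fun z : X × X => d (T z.1) (T z.2) :=
      (measurable_of_countable (fun q : Fin n × Fin n => d q.1 q.2)).comp
        ((hT.comp measurable_fst).prodMk (hT.comp measurable_snd))
    have hbd : ∀ (ρ : Measure (X × X)) [IsFiniteMeasure ρ],
        Integrable (fun z : X × X => d (T z.1) (T z.2)) ρ := by
      intro ρ _
      refine Integrable.of_bound hm.aestronglyMeasurable (∑ i, ∑ j, |d i j|)
        (Filter.Eventually.of_forall fun z => ?_)
      rw [Real.norm_eq_abs]
      exact (Finset.single_le_sum (f := fun j => |d (T z.1) j|) (fun j _ => abs_nonneg _)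
        (Finset.mem_univ (T z.2))).trans
        (Finset.single_le_sum (f := fun i => ∑ j, |d i j|)
          (fun i _ => Finset.sum_nonneg fun j _ => abs_nonneg _) (Finset.mem_univ (T z.1)))
    have hint : ∀ i j, Integrable (fun z : X × X => d (T z.1) (T z.2))
        (g i j • (μ.restrict (T ⁻¹' {i})).prod (ν.restrict (T ⁻¹' {j}))) :=
      fun i j => (hbd _).smul_measure ENNReal.ofReal_ne_top
    rw [integral_finsetSum_measure fun i _ => integrable_finsetSum_measure.mpr fun j _ => hint i j]
    refine Finset.sum_congr rfl fun i _ => ?_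
    rw [integral_finsetSum_measure fun j _ => hint i j]
    refine Finset.sum_congr rfl fun j _ => ?_
    rw [integral_smul_measure, Measure.prod_restrict]
    rw [setIntegral_congr_fun (g := fun _ => d i j) ((hA i).prod (hA j))
      (fun z hz => by
        have e1 : T z.1 = i := hz.1
        have e2 : T z.2 = j := hz.2
        simp only [e1, e2])]
    rw [setIntegral_const, measureReal_prod_prod, ENNReal.toReal_ofReal
      (div_nonneg (hp _ _) (mul_nonneg measureReal_nonneg measureReal_nonneg))]
    simp only [smul_eq_mul]
    by_cases hi : μ.real (T ⁻¹' {i}) = 0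
    · simp [hi, p1 i j hi]
    by_cases hj : ν.real (T ⁻¹' {j}) = 0
    · simp [hj, p2 i j hj]
    field_simp

theorem kr_integrable {X : Type*} [MetricSpace X] [PolishSpace X] [MeasurableSpace X]
    [BorelSpace X] (μ : Measure X) (hμ : MemP1 μ) (ψ : X → ℝ) (hψ : LipschitzWith 1 ψ) :
    Integrable ψ μ := by
  have := hμ.1
  obtain ⟨x₀⟩ : Nonempty X := μ.nonempty_of_neZero
  refine ((hμ.2 x₀).add (integrable_const |ψ x₀|)).mono'
    hψ.continuous.measurable.aestronglyMeasurable (Filter.Eventually.of_forall fun x => ?_)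
  have := hψ.dist_le_mul x x₀
  rw [Real.dist_eq, NNReal.coe_one, one_mul, dist_comm] at this
  rw [Real.norm_eq_abs]
  simp only [Pi.add_apply]
  have h3 := abs_add_le (ψ x - ψ x₀) (ψ x₀)
  rw [sub_add_cancel] at h3
  linarith

theorem kr_dist_integrable {X : Type*} [MetricSpace X] [PolishSpace X] [MeasurableSpace X]
    [BorelSpace X] (μ ν : Measure X) (hμ : MemP1 μ) (hν : MemP1 ν) (π : Measure (X × X))
    (h1 : π.map Prod.fst = μ) (h2 : π.map Prod.snd = ν) :
    Integrable (fun z : X × X => dist z.1 z.2) π := by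
  have := hμ.1
  obtain ⟨x₀⟩ : Nonempty X := μ.nonempty_of_neZero
  have i1 : Integrable (fun z : X × X => dist x₀ z.1) π :=
    (h1 ▸ hμ.2 x₀ : Integrable (fun x => dist x₀ x) (π.map Prod.fst)).comp_measurable measurable_fst
  have i2 : Integrable (fun z : X × X => dist x₀ z.2) π :=
    (h2 ▸ hν.2 x₀ : Integrable (fun x => dist x₀ x) (π.map Prod.snd)).comp_measurable measurable_snd
  refine (i1.add i2).mono' (measurable_fst.dist measurable_snd).aestronglyMeasurable
    (Filter.Eventually.of_forall fun z => ?_)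
  rw [Real.norm_of_nonneg dist_nonneg]
  exact dist_triangle_left _ _ _

theorem kr_weak {X : Type*} [MetricSpace X] [PolishSpace X] [MeasurableSpace X]
    [BorelSpace X] (μ ν : Measure X) (hμ : MemP1 μ) (hν : MemP1 ν) (π : Measure (X × X))
    (h1 : π.map Prod.fst = μ) (h2 : π.map Prod.snd = ν) (ψ : X → ℝ) (hψ : LipschitzWith 1 ψ) :
    (∫ x, ψ x ∂μ) - ∫ x, ψ x ∂ν ≤ ∫ z, dist z.1 z.2 ∂π := by
  have hd := kr_dist_integrable μ ν hμ hν π h1 h2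
  have i1 := kr_integrable μ hμ ψ hψ
  have i2 := kr_integrable ν hν ψ hψ
  subst h1 h2
  have hm := hψ.continuous.measurable
  have j1 : Integrable (fun z : X × X => ψ z.1) π := i1.comp_measurable measurable_fst
  have j2 : Integrable (fun z : X × X => ψ z.2) π := i2.comp_measurable measurable_snd
  rw [integral_map measurable_fst.aemeasurable hm.aestronglyMeasurable,
    integral_map measurable_snd.aemeasurable hm.aestronglyMeasurable,
    ← integral_sub j1 j2]
  refine integral_mono (j1.sub j2) hd fun z => ?_
  have := hψ.dist_le_mul z.1 z.2
  rw [Real.dist_eq, NNReal.coe_one, one_mul] at this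
  exact (le_abs_self _).trans this

theorem kr_integral_disc {X : Type*} [MeasurableSpace X] (μ : Measure X) [IsProbabilityMeasure μ]
    {n : ℕ} (T : X → Fin n) (hT : Measurable T) (f : Fin n → ℝ) :
    Integrable (fun x => f (T x)) μ ∧ ∫ x, f (T x) ∂μ = ∑ i, f i * μ.real (T ⁻¹' {i}) := by
  have : IsProbabilityMeasure (μ.map T) := Measure.isProbabilityMeasure_map hT.aemeasurable
  have hi : Integrable f (μ.map T) := Integrable.of_finite
  refine ⟨hi.comp_measurable hT, ?_⟩
  rw [← integral_map hT.aemeasurable hi.1, integral_fintype hi]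
  refine Finset.sum_congr rfl fun i _ => ?_
  rw [map_measureReal_apply hT (measurableSet_singleton i), smul_eq_mul, mul_comm]

theorem kr_approx {X : Type*} [MetricSpace X] [PolishSpace X] [MeasurableSpace X]
    [BorelSpace X] (μ ν : Measure X) (hμ : MemP1 μ) (hν : MemP1 ν) (S : ℝ)
    (hS : ∀ ψ : X → ℝ, LipschitzWith 1 ψ → (∫ x, ψ x ∂μ) - ∫ x, ψ x ∂ν ≤ S)
    (ε : ℝ) (hε : 0 < ε) :
    ∃ π : Measure (X × X), π.map Prod.fst = μ ∧ π.map Prod.snd = ν ∧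
      ∫ z, dist z.1 z.2 ∂π ≤ S + 4 * ε := by
  have := hμ.1
  have := hν.1
  obtain ⟨n, e, T, hT, hTμ, hTν⟩ := kr_discretize μ ν hμ hν ε hε
  have hsum : ∀ ρ : Measure X, IsProbabilityMeasure ρ → ∑ i, ρ.real (T ⁻¹' {i}) = 1 := by
    intro ρ _
    have := (kr_integral_disc ρ T hT (fun _ => 1)).2
    simpa using this.symm
  have hdint : ∀ ρ : Measure X, MemP1 ρ → Integrable (fun x => dist x (e (T x))) ρ := by
    intro ρ hρ
    have := hρ.1
    obtain ⟨x₀⟩ : Nonempty X := ρ.nonempty_of_neZero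
    refine ((hρ.2 x₀).add (kr_integral_disc ρ T hT (fun i => dist x₀ (e i))).1).mono'
      (measurable_id.dist ((measurable_of_countable e).comp hT)).aestronglyMeasurable
      (Filter.Eventually.of_forall fun x => ?_)
    rw [Real.norm_of_nonneg dist_nonneg]
    exact dist_triangle_left _ _ _
  have hex : ∃ p : Fin n → Fin n → ℝ, (∀ i j, 0 ≤ p i j) ∧
      (∀ i, ∑ j, p i j = μ.real (T ⁻¹' {i})) ∧ (∀ j, ∑ i, p i j = ν.real (T ⁻¹' {j})) ∧
      ∑ i, ∑ j, p i j * dist (e i) (e j) ≤ S + 2 * ε := by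
    by_contra! hcon
    obtain ⟨φ, χ, h1, h2⟩ := kr_finite (fun i j => dist (e i) (e j))
      (fun i => μ.real (T ⁻¹' {i})) (fun i => ν.real (T ⁻¹' {i}))
      (fun _ => measureReal_nonneg) (fun _ => measureReal_nonneg) (hsum μ hμ.1) (hsum ν hν.1)
      (S + 2 * ε) hcon
    have : Nonempty (Fin n) := by
      obtain ⟨x₀⟩ : Nonempty X := μ.nonempty_of_neZero
      exact ⟨T x₀⟩
    let ψ : X → ℝ := fun x => Finset.univ.inf' Finset.univ_nonempty (fun j => dist x (e j) - χ j)
    have hψ : LipschitzWith 1 ψ := by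
      refine LipschitzWith.of_le_add fun x y => ?_
      obtain ⟨j, -, hj⟩ := Finset.exists_mem_eq_inf' (Finset.univ_nonempty (α := Fin n))
        (fun j => dist y (e j) - χ j)
      have e1 : ψ y = dist y (e j) - χ j := hj
      have e2 : ψ x ≤ dist x (e j) - χ j := Finset.inf'_le _ (Finset.mem_univ j)
      have := dist_triangle x y (e j)
      linarith
    have hφ : ∀ i, φ i ≤ ψ (e i) := fun i => by
      refine Finset.le_inf' _ _ fun j _ => ?_
      have := h1 i j
      linarith
    have hχ : ∀ j, ψ (e j) ≤ - χ j := fun j => by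
      have : ψ (e j) ≤ dist (e j) (e j) - χ j := Finset.inf'_le _ (Finset.mem_univ j)
      simpa using this
    have hμ' := kr_integral_disc μ T hT (fun i => ψ (e i))
    have hν' := kr_integral_disc ν T hT (fun i => ψ (e i))
    have lip : ∀ x y, |ψ x - ψ y| ≤ dist x y := fun x y => by
      have := hψ.dist_le_mul x y
      rwa [Real.dist_eq, NNReal.coe_one, one_mul] at this
    have k1 : ∫ x, ψ (e (T x)) ∂μ ≤ ∫ x, ψ x ∂μ + ∫ x, dist x (e (T x)) ∂μ := by
      rw [← integral_add (kr_integrable μ hμ ψ hψ) (hdint μ hμ)]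
      refine integral_mono hμ'.1 ((kr_integrable μ hμ ψ hψ).add (hdint μ hμ)) fun x => ?_
      have := (abs_le.mp (lip x (e (T x)))).1
      simp only [Pi.add_apply]
      linarith
    have k2 : ∫ x, ψ x ∂ν ≤ ∫ x, ψ (e (T x)) ∂ν + ∫ x, dist x (e (T x)) ∂ν := by
      rw [← integral_add hν'.1 (hdint ν hν)]
      refine integral_mono (kr_integrable ν hν ψ hψ) (hν'.1.add (hdint ν hν)) fun x => ?_
      have := (abs_le.mp (lip x (e (T x)))).2
      simp only [Pi.add_apply]
      linarith
    have m1 : ∑ i, φ i * μ.real (T ⁻¹' {i}) ≤ ∑ i, ψ (e i) * μ.real (T ⁻¹' {i}) :=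
      Finset.sum_le_sum fun i _ => mul_le_mul_of_nonneg_right (hφ i) measureReal_nonneg
    have m2 : ∑ i, χ i * ν.real (T ⁻¹' {i}) ≤ - ∑ i, ψ (e i) * ν.real (T ⁻¹' {i}) := by
      rw [← Finset.sum_neg_distrib]
      refine Finset.sum_le_sum fun i _ => ?_
      rw [← neg_mul]
      exact mul_le_mul_of_nonneg_right (by linarith [hχ i]) measureReal_nonneg
    have := hS ψ hψ
    have q1 := hμ'.2
    have q2 := hν'.2
    linarith
  obtain ⟨p, hp, hp1, hp2, hpc⟩ := hex
  obtain ⟨π, hπ1, hπ2, hπ⟩ := kr_glue μ ν T hT p hp hp1 hp2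
  refine ⟨π, hπ1, hπ2, ?_⟩
  have hd := kr_dist_integrable μ ν hμ hν π hπ1 hπ2
  have hmeas : Measurable (fun x => dist x (e (T x))) :=
    measurable_id.dist ((measurable_of_countable e).comp hT)
  have i1 : Integrable (fun z : X × X => dist z.1 (e (T z.1))) π := by
    have := hdint μ hμ
    rw [← hπ1] at this
    exact this.comp_measurable measurable_fst
  have i2 : Integrable (fun z : X × X => dist z.2 (e (T z.2))) π := by
    have := hdint ν hν
    rw [← hπ2] at this
    exact this.comp_measurable measurable_snd
  have v1 : ∫ z, dist z.1 (e (T z.1)) ∂π = ∫ x, dist x (e (T x)) ∂μ := by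
    rw [← hπ1, integral_map measurable_fst.aemeasurable hmeas.aestronglyMeasurable]
  have v2 : ∫ z, dist z.2 (e (T z.2)) ∂π = ∫ x, dist x (e (T x)) ∂ν := by
    rw [← hπ2, integral_map measurable_snd.aemeasurable hmeas.aestronglyMeasurable]
  have i3 : Integrable (fun z : X × X => dist (e (T z.1)) (e (T z.2))) π := by
    refine ((hd.add i1).add i2).mono' (((measurable_of_countable e).comp
      (hT.comp measurable_fst)).dist ((measurable_of_countable e).comp
      (hT.comp measurable_snd))).aestronglyMeasurable (Filter.Eventually.of_forall fun z => ?_)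
    rw [Real.norm_of_nonneg dist_nonneg]
    have t1 := dist_triangle (e (T z.1)) z.1 (e (T z.2))
    have t2 := dist_triangle z.1 z.2 (e (T z.2))
    rw [dist_comm (e (T z.1)) z.1] at t1
    simp only [Pi.add_apply]
    linarith
  have v3 := hπ (fun i j => dist (e i) (e j))
  have : ∫ z, dist z.1 z.2 ∂π ≤ ∫ z, dist z.1 (e (T z.1)) + dist z.2 (e (T z.2)) +
      dist (e (T z.1)) (e (T z.2)) ∂π := by
    refine integral_mono hd ((i1.add i2).add i3) fun z => ?_
    have t1 := dist_triangle z.1 (e (T z.1)) z.2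
    have t2 := dist_triangle (e (T z.1)) (e (T z.2)) z.2
    rw [dist_comm (e (T z.2)) z.2] at t2
    simp only [Pi.add_apply]
    linarith
  have i12 : Integrable (fun z : X × X => dist z.1 (e (T z.1)) + dist z.2 (e (T z.2))) π :=
    i1.add i2
  rw [integral_add i12 i3, integral_add i1 i2] at this
  linarith

/-- (Kantorovich–Rubinstein duality.) For `μ, ν ∈ 𝒫_1(𝒳)` on a Polish
metric space, `W_1(μ, ν) = sup { ∫ ψ dμ − ∫ ψ dν : ψ 1-Lipschitz }`. -/
theorem kantorovich_rubinstein_duality {X : Type*}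
    [MetricSpace X] [PolishSpace X] [MeasurableSpace X] [BorelSpace X]
    (μ ν : Measure X) (hμ : MemP1 μ) (hν : MemP1 ν) :
    W1 μ ν = sSup {r : ℝ | ∃ ψ : X → ℝ, LipschitzWith 1 ψ ∧
      r = (∫ x, ψ x ∂μ) - ∫ x, ψ x ∂ν} := by
  have := hμ.1
  have := hν.1
  set R : Set ℝ := {r : ℝ | ∃ ψ : X → ℝ, LipschitzWith 1 ψ ∧
      r = (∫ x, ψ x ∂μ) - ∫ x, ψ x ∂ν} with hR
  have hprod1 : (μ.prod ν).map Prod.fst = μ := by simp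
  have hprod2 : (μ.prod ν).map Prod.snd = ν := by simp
  have hne : R.Nonempty := ⟨_, fun _ => 0, LipschitzWith.const' 0, rfl⟩
  have hbdd : BddAbove R := by
    refine ⟨∫ z, dist z.1 z.2 ∂(μ.prod ν), ?_⟩
    rintro r ⟨ψ, hψ, rfl⟩
    exact kr_weak μ ν hμ hν _ hprod1 hprod2 ψ hψ
  unfold W1
  apply le_antisymm
  · refine le_of_forall_pos_le_add fun ε hε => ?_
    obtain ⟨π, h1, h2, h3⟩ := kr_approx μ ν hμ hν (sSup R)
      (fun ψ hψ => le_csSup hbdd ⟨ψ, hψ, rfl⟩) (ε / 4) (by positivity)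
    refine le_trans (csInf_le (a := ∫ z, dist z.1 z.2 ∂π) ⟨0, ?_⟩ ⟨π, h1, h2, rfl⟩)
      (by linarith)
    rintro r ⟨ρ, -, -, rfl⟩
    exact integral_nonneg fun z => dist_nonneg
  · refine le_csInf ⟨_, μ.prod ν, hprod1, hprod2, rfl⟩ ?_
    rintro r ⟨π, h1, h2, rfl⟩
    refine csSup_le hne ?_
    rintro r ⟨ψ, hψ, rfl⟩
    exact kr_weak μ ν hμ hν π h1 h2 ψ hψ
end
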